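/- arXiv:math/0611684 — 11 statements merged into one kernel-verified Lean document; each statement's English description precedes it below -/
import Mathlib

section
/- Let α ∈ (0,1) and let F be a continuous, strictly increasing cumulative distribution function on ℝ with inverse F⁻¹ : (0,1) → ℝ. Define d₁(y) = F⁻¹(1 − α·F(y)), d₂(y) = F⁻¹(1/2 + ((1−α)/2)·F(y)), d(y) = max(d₁(y), d₂(y)), and d₀ = F⁻¹(1/(1+α)). Then: (i) d₁(d₀) = d₂(d₀) = d₀, so that d(d₀) = d₀; (ii) d₁ is strictly decreasing and d₂ is strictly increasing; (iii) d(y) ≥ d₀ for every y ∈ ℝ; and (iv) d(y) = d₁(y) if and only if y ≤ d₀. -/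
open Set Filter

/-- Lemma 1 of the paper: properties of `d₁`, `d₂`, `d` and the fixed point `d₀`,
for a continuous strictly increasing cdf `F` with inverse `Finv`. -/
theorem stmt0 (α : ℝ) (hα : α ∈ Set.Ioo (0:ℝ) 1)
    (F Finv : ℝ → ℝ)
    (hFcont : Continuous F) (hFmono : StrictMono F)
    (hFrange : ∀ y, F y ∈ Set.Ioo (0:ℝ) 1)
    (hF0 : Tendsto F atBot (nhds 0)) (hF1 : Tendsto F atTop (nhds 1))
    (hFinv : ∀ p, 0 < p → p < 1 → F (Finv p) = p)
    (d₁ d₂ d : ℝ → ℝ) (d₀ : ℝ)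
    (hd₁ : ∀ y, d₁ y = Finv (1 - α * F y))
    (hd₂ : ∀ y, d₂ y = Finv (1/2 + ((1 - α)/2) * F y))
    (hd : ∀ y, d y = max (d₁ y) (d₂ y))
    (hd₀ : d₀ = Finv (1/(1 + α))) :
    (d₁ d₀ = d₀ ∧ d₂ d₀ = d₀ ∧ d d₀ = d₀) ∧
    (StrictAnti d₁ ∧ StrictMono d₂) ∧
    (∀ y, d₀ ≤ d y) ∧
    (∀ y, d y = d₁ y ↔ y ≤ d₀) := by
  obtain ⟨hα0, hα1⟩ := hα
  have hF_d₁ (y : ℝ) : F (d₁ y) = 1 - α * F y := by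
    obtain ⟨h0, h1⟩ := hFrange y
    rw [hd₁]
    apply hFinv <;> nlinarith
  have hF_d₂ (y : ℝ) : F (d₂ y) = 1/2 + ((1 - α)/2) * F y := by
    obtain ⟨h0, h1⟩ := hFrange y
    rw [hd₂]
    apply hFinv <;> nlinarith
  have hF_d₀ : F d₀ = 1/(1 + α) := by
    rw [hd₀]
    apply hFinv
    · positivity
    · rw [div_lt_one (by linarith)]
      linarith
  have hα_ne : 1 + α ≠ 0 := by linarith
  have hfix₁ : d₁ d₀ = d₀ := by
    apply hFmono.injective
    rw [hF_d₁, hF_d₀]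
    field_simp
    ring
  have hfix₂ : d₂ d₀ = d₀ := by
    apply hFmono.injective
    rw [hF_d₂, hF_d₀]
    field_simp
    ring
  have hanti : StrictAnti d₁ := by
    intro x y hxy
    rw [← hFmono.lt_iff_lt, hF_d₁, hF_d₁]
    linarith [mul_lt_mul_of_pos_left (hFmono hxy) hα0]
  have hmono : StrictMono d₂ := by
    intro x y hxy
    rw [← hFmono.lt_iff_lt, hF_d₂, hF_d₂]
    linarith [mul_lt_mul_of_pos_left (hFmono hxy) (show 0 < (1 - α)/2 by linarith)]
  refine ⟨⟨hfix₁, hfix₂, by rw [hd, hfix₁, hfix₂, max_self]⟩, ⟨hanti, hmono⟩, ?_, ?_⟩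
  · intro y
    rw [hd]
    rcases le_total y d₀ with h | h
    · exact le_max_of_le_left (hfix₁ ▸ hanti.antitone h)
    · exact le_max_of_le_right (hfix₂ ▸ hmono.monotone h)
  · intro y
    rw [hd, max_eq_left_iff]
    constructor
    · intro h
      by_contra! hy
      linarith [hanti hy, hmono hy]
    · intro h
      linarith [hanti.antitone h, hmono.monotone h]
end

section
/- Fix m ∈ ℝ and c > 0, and let μ be the probability measure on ℝ with density y ↦ g((y−m)/c)·1_{[0,∞)}(y) / (c·G(m/c)) with respect to Lebesgue measure (the truncation to [0,∞) of the location–scale density, normalized using G(m/c) = ∫₀^∞ g((y−m)/c) dy/c by symmetry of g). Then the interval I* = [max(0, m − c·d(m/c)), m + c·d(m/c)] satisfies μ(I*) = 1 − α, and every interval [l, u] ⊆ ℝ with μ([l, u]) ≥ 1 − α has length u − l at least the length of I*; that is, I* is the highest-posterior-density (shortest) interval of μ-probability 1 − α. -/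
open Set Filter MeasureTheory

section SymmetricUnimodal

variable {g G : ℝ → ℝ}

lemma apply_le_apply_of_abs_le (hg_symm : ∀ t, g (-t) = g t) (hg_decr : StrictAntiOn g (Ici 0))
    {x y : ℝ} (h : |x| ≤ |y|) : g y ≤ g x := by
  have habs : ∀ t, g |t| = g t := fun t => by
    rcases abs_choice t with ht | ht <;> rw [ht]
    exact hg_symm t
  rw [← habs x, ← habs y]
  exact hg_decr.antitoneOn (abs_nonneg x) (abs_nonneg y) h

lemma cdf_sub_cdf (hg_int : Integrable g) (hG : ∀ y, G y = ∫ t in Iic y, g t) (x y : ℝ) :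
    G y - G x = ∫ t in x..y, g t := by
  rw [hG, hG]
  exact intervalIntegral.integral_Iic_sub_Iic hg_int.integrableOn hg_int.integrableOn

lemma cdf_strictMono (hg_pos : ∀ t, 0 < g t) (hg_int : Integrable g)
    (hG : ∀ y, G y = ∫ t in Iic y, g t) : StrictMono G := by
  intro x y hxy
  rw [← sub_pos, cdf_sub_cdf hg_int hG]
  exact intervalIntegral.intervalIntegral_pos_of_pos hg_int.intervalIntegrable hg_pos hxy

lemma cdf_neg (hg_symm : ∀ t, g (-t) = g t) (hg_int : Integrable g) (hg_one : ∫ t, g t = 1)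
    (hG : ∀ y, G y = ∫ t in Iic y, g t) (y : ℝ) : G (-y) = 1 - G y := by
  have h₁ : G (-y) = ∫ t in Ioi y, g t := by
    rw [hG, ← neg_neg y, ← integral_comp_neg_Iic, neg_neg]
    simp only [hg_symm]
  have h₂ := intervalIntegral.integral_Iic_add_Ioi (b := y) hg_int.integrableOn
    hg_int.integrableOn
  rw [← hG, hg_one] at h₂
  linarith

/-- Shifting an interval whose midpoint is nonnegative to the right decreases its mass. -/
lemma cdf_sub_cdf_shift_le (hg_symm : ∀ t, g (-t) = g t) (hg_decr : StrictAntiOn g (Ici 0))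
    (hg_int : Integrable g) (hG : ∀ y, G y = ∫ t in Iic y, g t)
    {x y s : ℝ} (hxy : x ≤ y) (hsum : 0 ≤ x + y) (hs : 0 ≤ s) :
    G (y + s) - G (x + s) ≤ G y - G x := by
  have key : G (y + s) - G y ≤ G (x + s) - G x := by
    have hshift : ∀ z, G (z + s) - G z = ∫ t in (0:ℝ)..s, g (t + z) := fun z => by
      rw [cdf_sub_cdf hg_int hG, intervalIntegral.integral_comp_add_right, zero_add, add_comm]
    rw [hshift, hshift]
    refine intervalIntegral.integral_mono_on hs (hg_int.comp_add_right y).intervalIntegrable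
      (hg_int.comp_add_right x).intervalIntegrable fun t ht => ?_
    refine apply_le_apply_of_abs_le hg_symm hg_decr ((abs_le.2 ⟨?_, ?_⟩).trans (le_abs_self _)) <;>
      linarith [ht.1]
  linarith

/-- Among intervals bounded below by `-M`, none shorter than `[max (-M) (-D), D]` has as much
mass. -/
lemma cdf_sub_cdf_lt_of_length_lt (hg_pos : ∀ t, 0 < g t) (hg_symm : ∀ t, g (-t) = g t)
    (hg_decr : StrictAntiOn g (Ici 0)) (hg_int : Integrable g) (hg_one : ∫ t, g t = 1)
    (hG : ∀ y, G y = ∫ t in Iic y, g t) {M D a b : ℝ} (hD : 0 ≤ D) (hMD : -M ≤ D)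
    (ha : -M ≤ a) (hab : b - a < D - max (-M) (-D)) :
    G b - G a < G D - G (max (-M) (-D)) := by
  have hmono := cdf_strictMono hg_pos hg_int hG
  set A := max (-M) (-D) with hA
  have hAD : A ≤ D := max_le hMD (by linarith)
  have hA' : -D ≤ A := le_max_right _ _
  rcases le_or_gt A a with h | h
  · have h₁ := cdf_sub_cdf_shift_le hg_symm hg_decr hg_int hG hAD (by linarith) (sub_nonneg.2 h)
    have h₂ : G b < G (D + (a - A)) := hmono (by linarith)
    rw [add_sub_cancel] at h₁
    linarith
  · have hAeq : A = -D := by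
      rcases max_choice (-M) (-D) with h' | h' <;> rw [← hA] at h' <;> linarith
    have h₁ := cdf_sub_cdf_shift_le hg_symm hg_decr hg_int hG hAD (by linarith)
      (sub_nonneg.2 h.le)
    have h₂ : G b < G (-(A + (A - a))) := hmono (by linarith)
    have h₃ : G a = G (-(D + (A - a))) := by congr 1; linarith
    rw [cdf_neg hg_symm hg_int hg_one hG] at h₂ h₃
    linarith

lemma truncated_measure_Icc (hg_pos : ∀ t, 0 < g t) (hg_int : Integrable g)
    (hG : ∀ y, G y = ∫ t in Iic y, g t) {m c K : ℝ} (hc : 0 < c) (hK : 0 < K) {l u : ℝ}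
    (hlu : max 0 l ≤ u) :
    ((volume.withDensity (fun y => ENNReal.ofReal (Set.indicator (Ici 0)
        (fun z => g ((z - m)/c) / (c * K)) y))) (Icc l u)).toReal =
      (G ((u - m)/c) - G ((max 0 l - m)/c)) / K := by
  have hind : (fun y => ENNReal.ofReal (Set.indicator (Ici 0)
        (fun z => g ((z - m)/c) / (c * K)) y)) =
      (Ici (0:ℝ)).indicator (fun y => ENNReal.ofReal (g ((y - m)/c) / (c * K))) := by
    ext y
    by_cases hy : y ∈ Ici (0:ℝ) <;> simp [hy]
  have hset : Icc l u ∩ Ici 0 = Icc (max 0 l) u := by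
    ext y
    simp only [mem_inter_iff, mem_Icc, mem_Ici, max_le_iff]
    tauto
  have hint : Integrable fun y => g ((y - m)/c) / (c * K) :=
    ((hg_int.comp_div hc.ne').comp_sub_right m).div_const _
  rw [hind, withDensity_indicator measurableSet_Ici, withDensity_apply _ measurableSet_Icc,
    Measure.restrict_restrict measurableSet_Icc, hset,
    ← ofReal_integral_eq_lintegral_ofReal hint.integrableOn
      (Eventually.of_forall fun y => (div_pos (hg_pos _) (mul_pos hc hK)).le),
    ENNReal.toReal_ofReal
      (integral_nonneg fun y => (div_pos (hg_pos _) (mul_pos hc hK)).le),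
    integral_Icc_eq_integral_Ioc, ← intervalIntegral.integral_of_le hlu,
    intervalIntegral.integral_div, cdf_sub_cdf hg_int hG]
  simp only [sub_div]
  rw [intervalIntegral.integral_comp_div_sub _ hc.ne', smul_eq_mul]
  field_simp

end SymmetricUnimodal

/-- The HPD (shortest) `1 - α` credible interval for the truncation to `[0, ∞)` of a
symmetric strictly unimodal location–scale density is
`[max(0, m - c·d(m/c)), m + c·d(m/c)]`. -/
theorem stmt1 (α : ℝ) (hα : α ∈ Set.Ioo (0:ℝ) 1)
    (g G Ginv : ℝ → ℝ)
    (hg_pos : ∀ t, 0 < g t)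
    (hg_symm : ∀ t, g (-t) = g t)
    (hg_incr : StrictMonoOn g (Iic 0))
    (hg_decr : StrictAntiOn g (Ici 0))
    (hg_int : Integrable g)
    (hg_one : ∫ t, g t = 1)
    (hG : ∀ y, G y = ∫ t in Iic y, g t)
    (hGinv : ∀ p, 0 < p → p < 1 → G (Ginv p) = p)
    (d₁ d₂ d : ℝ → ℝ)
    (hd₁ : ∀ y, d₁ y = Ginv (1 - α * G y))
    (hd₂ : ∀ y, d₂ y = Ginv (1/2 + ((1 - α)/2) * G y))
    (hd : ∀ y, d y = max (d₁ y) (d₂ y))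
    (m c : ℝ) (hc : 0 < c)
    (μ : Measure ℝ)
    (hμ : μ = volume.withDensity
      (fun y => ENNReal.ofReal (Set.indicator (Ici 0)
        (fun z => g ((z - m)/c) / (c * G (m/c))) y))) :
    (μ (Icc (max 0 (m - c * d (m/c))) (m + c * d (m/c)))).toReal = 1 - α ∧
    ∀ l u : ℝ, (1 - α : ℝ) ≤ (μ (Icc l u)).toReal →
      (m + c * d (m/c)) - max 0 (m - c * d (m/c)) ≤ u - l := by
  obtain ⟨hα0, hα1⟩ := hα
  have hmono := cdf_strictMono hg_pos hg_int hG
  have hneg := cdf_neg hg_symm hg_int hg_one hG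
  have hG_nonneg : ∀ y, 0 ≤ G y := fun y => by
    rw [hG]
    exact integral_nonneg fun t => (hg_pos t).le
  have hG_pos : ∀ y, 0 < G y := fun y => (hG_nonneg (y - 1)).trans_lt (hmono (by linarith))
  have hG_lt : ∀ y, G y < 1 := fun y => by linarith [hneg y, hG_pos (-y)]
  set M := m / c with hM
  set D := d M with hD
  have hK := hG_pos M
  have hK1 := hG_lt M
  have hαK : α * G M < G M := by nlinarith
  have hαK0 : 0 < α * G M := mul_pos hα0 hK
  have hG₁ : G (d₁ M) = 1 - α * G M := by
    rw [hd₁]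
    exact hGinv _ (by linarith) (by linarith)
  have hG₂ : G (d₂ M) = 1/2 + ((1 - α)/2) * G M := by
    rw [hd₂]
    exact hGinv _ (by linarith) (by linarith)
  have hG0 : G 0 = 1/2 := by
    have := hneg 0
    rw [neg_zero] at this
    linarith
  have hD₁ : d₁ M ≤ D := by rw [hD, hd]; exact le_max_left _ _
  have hD₂ : d₂ M ≤ D := by rw [hD, hd]; exact le_max_right _ _
  have hD0 : 0 < D := (hmono.lt_iff_lt.1 (by rw [hG0, hG₂]; linarith)).trans_le hD₂
  have hMD : -M < D := (hmono.lt_iff_lt.1 (by rw [hneg, hG₁]; linarith)).trans_le hD₁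
  have hmass : G D - G (max (-M) (-D)) = (1 - α) * G M := by
    rcases le_total (d₂ M) (d₁ M) with h | h
    · have hDeq : D = d₁ M := by rw [hD, hd, max_eq_left h]
      have h' := hmono.monotone h
      have hMle : M ≤ D := by
        rw [hDeq]
        exact hmono.le_iff_le.1 (by linarith)
      rw [max_eq_left (neg_le_neg hMle), hneg, hDeq, hG₁]
      ring
    · have hDeq : D = d₂ M := by rw [hD, hd, max_eq_right h]
      have h' := hmono.monotone h
      have hMle : D ≤ M := by
        rw [hDeq]
        exact hmono.le_iff_le.1 (by linarith)
      rw [max_eq_right (neg_le_neg hMle), hneg, hDeq, hG₂]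
      ring
  have hcM : c * M = m := by rw [hM]; field_simp
  have hmax : max 0 (m - c * D) = m + c * max (-M) (-D) := by
    rw [mul_max_of_nonneg _ _ hc.le, ← max_add_add_left]
    congr 1 <;> linarith
  have hstd : ∀ t, (m + c * t - m) / c = t := fun t => by field_simp; ring
  have hlt : max (-M) (-D) < D := max_lt hMD (by linarith)
  rw [hmax, hμ]
  constructor
  · have h0 : max 0 (m + c * max (-M) (-D)) = m + c * max (-M) (-D) := by
      rw [← hmax, max_eq_right (le_max_left _ _)]
    rw [truncated_measure_Icc hg_pos hg_int hG hc hK (by rw [h0]; gcongr), h0, hstd, hstd, hmass,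
      mul_div_cancel_right₀ _ hK.ne']
  · intro l u hlu
    rcases le_or_gt (max 0 l) u with h | h
    · rw [truncated_measure_Icc hg_pos hg_int hG hc hK h, le_div_iff₀ hK, ← hmass] at hlu
      have ha : -M ≤ (max 0 l - m) / c := by
        rw [le_div_iff₀ hc]
        linarith [le_max_left 0 l]
      have hlen := not_lt.1 fun hab => hlu.not_gt <| cdf_sub_cdf_lt_of_length_lt hg_pos hg_symm
        hg_decr hg_int hg_one hG hD0.le hMD.le ha hab
      rw [← sub_div, le_div_iff₀ hc] at hlen
      linarith [le_max_right 0 l]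
    · have hzero : (volume.withDensity (fun y => ENNReal.ofReal (Set.indicator (Ici 0)
          (fun z => g ((z - m)/c) / (c * G M)) y))) (Icc l u) = 0 := by
        rw [withDensity_apply _ measurableSet_Icc]
        refine setLIntegral_eq_zero measurableSet_Icc fun y hy => ?_
        have hy0 : y ∉ Ici (0:ℝ) := fun hy' => h.not_ge (max_le (hy'.trans hy.2) (hy.1.trans hy.2))
        simp [hy0]
      rw [hzero, ENNReal.toReal_zero] at hlu
      linarith
end

section
/- Let (Ω, 𝓕, P) be a probability space, S a measurable space, X : Ω → S a random element, a₁, a₂ : S → ℝ measurable functions with a₂ > 0 everywhere, and τ ≥ 0 a real number. Assume the random variable T = (a₁(X) − τ)/a₂(X) has cumulative distribution function G. Define l(X) = max(0, a₁(X) − a₂(X)·d(a₁(X)/a₂(X))) and u(X) = a₁(X) + a₂(X)·d(a₁(X)/a₂(X)). Then P(l(X) ≤ τ ≤ u(X)) ≥ (1−α)/(1+α). -/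
open Set Filter MeasureTheory

/-- The distribution function of an everywhere positive density is strictly increasing. -/
theorem strictMono_setIntegral_Iic {g : ℝ → ℝ} (hpos : ∀ t, 0 < g t) (hint : Integrable g) :
    StrictMono fun y => ∫ t in Iic y, g t := by
  intro x y hxy
  have hsub := intervalIntegral.integral_Iic_sub_Iic (hint.integrableOn (s := Iic x))
    (hint.integrableOn (s := Iic y))
  have := intervalIntegral.intervalIntegral_pos_of_pos hint.intervalIntegrable hpos hxy
  simp only
  linarith

/-- The distribution function of an even density satisfies `G (-y) = 1 - G y`. -/
theorem setIntegral_Iic_neg_of_even {g : ℝ → ℝ} (hsymm : ∀ t, g (-t) = g t)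
    (hint : Integrable g) (y : ℝ) :
    ∫ t in Iic (-y), g t = (∫ t, g t) - ∫ t in Iic y, g t := by
  have hneg := integral_comp_neg_Iic (-y) g
  simp only [hsymm, neg_neg] at hneg
  have hsplit := intervalIntegral.integral_Iic_add_Ioi (hint.integrableOn (s := Iic y))
    (hint.integrableOn (s := Ioi y))
  linarith

/-- Theorem 1(b) of the paper: the frequentist coverage probability of the
credible interval `[max(0, a₁(X) - a₂(X)·d(a₁(X)/a₂(X))), a₁(X) + a₂(X)·d(a₁(X)/a₂(X))]`
for `τ ≥ 0` is at least `(1-α)/(1+α)`, whenever the pivot `(a₁(X) - τ)/a₂(X)` has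
symmetric strictly unimodal cdf `G`. -/
theorem stmt2 {Ω S : Type*} [MeasurableSpace Ω] [MeasurableSpace S]
    (P : Measure Ω) [IsProbabilityMeasure P]
    (α : ℝ) (hα : α ∈ Set.Ioo (0:ℝ) 1)
    (g G Ginv : ℝ → ℝ)
    (hg_pos : ∀ t, 0 < g t)
    (hg_symm : ∀ t, g (-t) = g t)
    (hg_incr : StrictMonoOn g (Iic 0))
    (hg_decr : StrictAntiOn g (Ici 0))
    (hg_int : Integrable g)
    (hg_one : ∫ t, g t = 1)
    (hG : ∀ y, G y = ∫ t in Iic y, g t)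
    (hGinv : ∀ p, 0 < p → p < 1 → G (Ginv p) = p)
    (d₁ d₂ d : ℝ → ℝ)
    (hd₁ : ∀ y, d₁ y = Ginv (1 - α * G y))
    (hd₂ : ∀ y, d₂ y = Ginv (1/2 + ((1 - α)/2) * G y))
    (hd : ∀ y, d y = max (d₁ y) (d₂ y))
    (X : Ω → S) (hX : Measurable X)
    (a₁ a₂ : S → ℝ) (ha₁ : Measurable a₁) (ha₂ : Measurable a₂)
    (ha₂pos : ∀ s, 0 < a₂ s)
    (τ : ℝ) (hτ : 0 ≤ τ)
    (hT : ∀ y : ℝ, (P {ω | (a₁ (X ω) - τ) / a₂ (X ω) ≤ y}).toReal = G y) :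
    (1 - α) / (1 + α) ≤
      (P {ω | max 0 (a₁ (X ω) - a₂ (X ω) * d (a₁ (X ω) / a₂ (X ω))) ≤ τ ∧
              τ ≤ a₁ (X ω) + a₂ (X ω) * d (a₁ (X ω) / a₂ (X ω))}).toReal := by
  obtain ⟨hα0, hα1⟩ := hα
  have hmono : StrictMono G := by
    rw [funext hG]
    exact strictMono_setIntegral_Iic hg_pos hg_int
  have hG_neg (y : ℝ) : G (-y) = 1 - G y := by
    rw [hG, hG, setIntegral_Iic_neg_of_even hg_symm hg_int, hg_one]
  have hG_pos (y : ℝ) : 0 < G y := by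
    have hnonneg : 0 ≤ G (y - 1) := hT (y - 1) ▸ ENNReal.toReal_nonneg
    linarith [hmono (sub_one_lt y)]
  have hG_lt (y : ℝ) : G y < 1 := by linarith [hG_pos (-y), hG_neg y]
  set c := Ginv (1 / (1 + α))
  have hGc : G c = 1 / (1 + α) :=
    hGinv _ (by positivity) (by rw [div_lt_one (by linarith)]; linarith)
  have hcd (y : ℝ) : c ≤ d y := by
    by_contra! hlt
    rw [hd, max_lt_iff, hd₁, hd₂] at hlt
    have h₁ := hmono hlt.1
    have h₂ := hmono hlt.2
    have hp := hG_pos y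
    have hl := hG_lt y
    rw [hGinv _ (by nlinarith) (by nlinarith), hGc, lt_div_iff₀ (by linarith)] at h₁ h₂
    nlinarith
  have hsub : {ω | (a₁ (X ω) - τ) / a₂ (X ω) ≤ c} ⊆
      {ω | max 0 (a₁ (X ω) - a₂ (X ω) * d (a₁ (X ω) / a₂ (X ω))) ≤ τ ∧
        τ ≤ a₁ (X ω) + a₂ (X ω) * d (a₁ (X ω) / a₂ (X ω))} ∪
      {ω | (a₁ (X ω) - τ) / a₂ (X ω) ≤ -c} := by
    intro ω hω
    by_cases hneg : (a₁ (X ω) - τ) / a₂ (X ω) ≤ -c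
    · exact Or.inr hneg
    left
    have ha := ha₂pos (X ω)
    have hle := mul_le_mul_of_nonneg_left (hcd (a₁ (X ω) / a₂ (X ω))) ha.le
    rw [mem_ofPred_eq, div_le_iff₀ ha] at hω
    rw [not_le, lt_div_iff₀ ha] at hneg
    exact ⟨max_le hτ (by linarith), by linarith⟩
  have hle := (measureReal_mono (μ := P) hsub).trans (measureReal_union_le _ _)
  simp only [measureReal_def] at hle
  rw [hT, hT, hG_neg, hGc] at hle
  have hval : (1 - α) / (1 + α) = 1 / (1 + α) - (1 - 1 / (1 + α)) := by
    field_simp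
    ring
  linarith
end

section
/- Let (Ω, 𝓕, P) be a probability space, S a measurable space, X : Ω → S a random element, and a₁, a₂ : S → ℝ measurable functions with a₂ > 0 everywhere. Assume the random variable T = a₁(X)/a₂(X) has cumulative distribution function G (this is the pivot when τ = 0). Define l(X) = max(0, a₁(X) − a₂(X)·d(a₁(X)/a₂(X))) and u(X) = a₁(X) + a₂(X)·d(a₁(X)/a₂(X)). Then P(l(X) ≤ 0 ≤ u(X)) = P(l(X) = 0) = P(a₁(X)/a₂(X) ≤ d₀) = 1/(1+α). -/
open Set Filter MeasureTheory

theorem strictMono_integral_Iic_of_pos {g : ℝ → ℝ} (hg : Integrable g)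
    (hpos : ∀ t, 0 < g t) : StrictMono fun y => ∫ t in Iic y, g t := by
  intro x y hxy
  have h := intervalIntegral.integral_Iic_sub_Iic (μ := volume)
    (hg.integrableOn (s := Iic x)) (hg.integrableOn (s := Iic y))
  have h' := intervalIntegral.intervalIntegral_pos_of_pos hg.intervalIntegrable hpos hxy
  dsimp only
  linarith

theorem integral_Iic_neg_of_even {g : ℝ → ℝ} (hg : Integrable g)
    (heven : ∀ t, g (-t) = g t) (y : ℝ) :
    ∫ t in Iic (-y), g t = (∫ t, g t) - ∫ t in Iic y, g t := by
  have h := integral_comp_neg_Iic (-y) g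
  simp only [heven, neg_neg] at h
  have h' := integral_add_compl (measurableSet_Iic (a := y)) hg
  rw [compl_Iic] at h'
  linarith

/-- Theorem 1(c) of the paper: at the boundary `τ = 0`, the coverage probability of the
credible interval equals `P(l(X) = 0) = P(a₁(X)/a₂(X) ≤ d₀) = 1/(1+α)`. -/
theorem stmt3 {Ω S : Type*} [MeasurableSpace Ω] [MeasurableSpace S]
    (P : Measure Ω) [IsProbabilityMeasure P]
    (α : ℝ) (hα : α ∈ Set.Ioo (0:ℝ) 1)
    (g G Ginv : ℝ → ℝ)
    (hg_pos : ∀ t, 0 < g t)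
    (hg_symm : ∀ t, g (-t) = g t)
    (hg_incr : StrictMonoOn g (Iic 0))
    (hg_decr : StrictAntiOn g (Ici 0))
    (hg_int : Integrable g)
    (hg_one : ∫ t, g t = 1)
    (hG : ∀ y, G y = ∫ t in Iic y, g t)
    (hGinv : ∀ p, 0 < p → p < 1 → G (Ginv p) = p)
    (d₁ d₂ d : ℝ → ℝ) (d₀ : ℝ)
    (hd₁ : ∀ y, d₁ y = Ginv (1 - α * G y))
    (hd₂ : ∀ y, d₂ y = Ginv (1/2 + ((1 - α)/2) * G y))
    (hd : ∀ y, d y = max (d₁ y) (d₂ y))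
    (hd₀ : d₀ = Ginv (1/(1 + α)))
    (X : Ω → S) (hX : Measurable X)
    (a₁ a₂ : S → ℝ) (ha₁ : Measurable a₁) (ha₂ : Measurable a₂)
    (ha₂pos : ∀ s, 0 < a₂ s)
    (hT : ∀ y : ℝ, (P {ω | a₁ (X ω) / a₂ (X ω) ≤ y}).toReal = G y) :
    (P {ω | max 0 (a₁ (X ω) - a₂ (X ω) * d (a₁ (X ω) / a₂ (X ω))) ≤ 0 ∧
            (0:ℝ) ≤ a₁ (X ω) + a₂ (X ω) * d (a₁ (X ω) / a₂ (X ω))}).toReal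
      = (P {ω | max 0 (a₁ (X ω) - a₂ (X ω) * d (a₁ (X ω) / a₂ (X ω))) = 0}).toReal ∧
    (P {ω | max 0 (a₁ (X ω) - a₂ (X ω) * d (a₁ (X ω) / a₂ (X ω))) = 0}).toReal
      = (P {ω | a₁ (X ω) / a₂ (X ω) ≤ d₀}).toReal ∧
    (P {ω | a₁ (X ω) / a₂ (X ω) ≤ d₀}).toReal = 1 / (1 + α) := by
  obtain ⟨hα0, hα1⟩ := hα
  have hα' : 0 < 1 + α := by linarith
  have hmono : StrictMono G := by
    rw [funext hG]
    exact strictMono_integral_Iic_of_pos hg_int hg_pos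
  have hneg (y : ℝ) : G (-y) = 1 - G y := by
    rw [hG, hG, integral_Iic_neg_of_even hg_int hg_symm, hg_one]
  have hG0 (y : ℝ) : 0 < G y := by
    refine lt_of_le_of_lt ?_ (hmono (sub_one_lt y))
    rw [← hT]
    exact ENNReal.toReal_nonneg
  have hG1 (y : ℝ) : G y < 1 := by
    have := hneg y
    have := hG0 (-y)
    linarith
  have hGd₀ : G d₀ = 1 / (1 + α) := by
    rw [hd₀]
    exact hGinv _ (by positivity) (by rw [div_lt_one hα']; linarith)
  have hGd₁ (y : ℝ) : G (d₁ y) = 1 - α * G y := by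
    rw [hd₁]
    exact hGinv _ (by nlinarith [hG0 y, hG1 y]) (by nlinarith [hG0 y])
  have hGd₂ (y : ℝ) : G (d₂ y) = 1/2 + ((1 - α)/2) * G y := by
    rw [hd₂]
    exact hGinv _ (by nlinarith [hG0 y]) (by nlinarith [hG0 y, hG1 y])
  have hle_iff (y : ℝ) : y ≤ d y ↔ y ≤ d₀ := by
    rw [hd, le_max_iff, ← hmono.le_iff_le (b := d₁ y), ← hmono.le_iff_le (b := d₂ y),
      ← hmono.le_iff_le (b := d₀), hGd₁, hGd₂, hGd₀, le_div_iff₀ hα']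
    constructor
    · rintro (h | h) <;> linarith
    · intro h
      left
      linarith
  have hneg_le (y : ℝ) : -y ≤ d y := by
    rw [hd]
    refine le_max_of_le_left ?_
    rw [← hmono.le_iff_le, hneg, hGd₁]
    nlinarith [hG0 y]
  have hupper (s : S) : 0 ≤ a₁ s + a₂ s * d (a₁ s / a₂ s) := by
    have h := hneg_le (a₁ s / a₂ s)
    rw [← neg_div, div_le_iff₀ (ha₂pos s)] at h
    linarith
  have hlower (s : S) :
      max 0 (a₁ s - a₂ s * d (a₁ s / a₂ s)) = 0 ↔ a₁ s / a₂ s ≤ d₀ := by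
    rw [max_eq_left_iff, sub_nonpos, ← hle_iff, div_le_iff₀' (ha₂pos s)]
  refine ⟨?_, ?_, ?_⟩
  · congr 3
    ext ω
    have h := le_max_left 0 (a₁ (X ω) - a₂ (X ω) * d (a₁ (X ω) / a₂ (X ω)))
    exact ⟨fun hω => le_antisymm hω.1 h, fun hω => ⟨hω.le, hupper _⟩⟩
  · simp only [hlower]
  · rw [hT, hGd₀]
end

section
/- Let g and g₁ be probability densities on ℝ, each symmetric about 0, with g positive on all of ℝ, and suppose the likelihood ratio y ↦ g₁(y)/g(y) is nonincreasing on (0, ∞). Let G and G₁ be the corresponding cumulative distribution functions. Then G₁(y) ≥ G(y) for every y ≥ 0. In particular, with d₀ = G⁻¹(1/(1+α)) for α ∈ (0,1), one has G₁(d₀) ≥ G(d₀) and hence 2·G₁(d₀) − 1 ≥ (1−α)/(1+α). -/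
open Set Filter MeasureTheory

/-- An even integrable function on `ℝ` has half of its integral on `(-∞, 0]`. -/
theorem integral_Iic_zero_of_even {f : ℝ → ℝ} (hf : Integrable f) (hsymm : ∀ t, f (-t) = f t) :
    ∫ t in Iic 0, f t = (∫ t, f t) / 2 := by
  have h := integral_comp_neg_Iic (0 : ℝ) f
  simp only [hsymm, neg_zero] at h
  have h' := intervalIntegral.integral_Iic_add_Ioi (b := (0 : ℝ)) hf.integrableOn hf.integrableOn
  linarith

theorem integral_Iic_eq_add_integral_Ioc {f : ℝ → ℝ} (hf : Integrable f) {a b : ℝ} (hab : a ≤ b) :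
    ∫ t in Iic b, f t = (∫ t in Iic a, f t) + ∫ t in Ioc a b, f t := by
  rw [← Iic_union_Ioc_eq_Iic hab]
  exact setIntegral_union (Iic_disjoint_Ioc le_rfl) measurableSet_Ioc
    hf.integrableOn hf.integrableOn

/-- If the likelihood ratio `g₁ / g` of two even functions of integral one is nonincreasing on `(0, ∞)`, then the
integral of `g₁` over `(-∞, y]` is at least that of `g` for `y` in `[0, ∞)`. -/
theorem integral_Iic_le_of_antitoneOn_div {g g₁ : ℝ → ℝ}
    (hg_pos : ∀ t, 0 < g t)
    (hg_symm : ∀ t, g (-t) = g t) (hg₁_symm : ∀ t, g₁ (-t) = g₁ t)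
    (hg_int : Integrable g) (hg₁_int : Integrable g₁)
    (hg_one : ∫ t, g t = 1) (hg₁_one : ∫ t, g₁ t = 1)
    (hLR : AntitoneOn (fun y => g₁ y / g y) (Ioi 0)) {y : ℝ} (hy : 0 ≤ y) :
    ∫ t in Iic y, g t ≤ ∫ t in Iic y, g₁ t := by
  have hg_half := integral_Iic_zero_of_even hg_int hg_symm
  have hg₁_half := integral_Iic_zero_of_even hg₁_int hg₁_symm
  rcases hy.eq_or_lt with rfl | hy
  · rw [hg_half, hg₁_half, hg_one, hg₁_one]
  have hM₁ : g₁ y / g y * ∫ t in Ioc 0 y, g t ≤ ∫ t in Ioc 0 y, g₁ t := by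
    rw [← integral_const_mul]
    refine setIntegral_mono_on (hg_int.const_mul _).integrableOn hg₁_int.integrableOn
      measurableSet_Ioc fun t ht => ?_
    exact (le_div_iff₀ (hg_pos t)).1 (hLR ht.1 hy ht.2)
  have hT₁ : ∫ t in Ioi y, g₁ t ≤ g₁ y / g y * ∫ t in Ioi y, g t := by
    rw [← integral_const_mul]
    refine setIntegral_mono_on hg₁_int.integrableOn (hg_int.const_mul _).integrableOn
      measurableSet_Ioi fun t ht => ?_
    exact (div_le_iff₀ (hg_pos t)).1 (hLR hy (hy.trans ht) (le_of_lt ht))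
  have hM : 0 ≤ ∫ t in Ioc 0 y, g t := integral_nonneg fun t => (hg_pos t).le
  have hT : 0 ≤ ∫ t in Ioi y, g t := integral_nonneg fun t => (hg_pos t).le
  have hsplit := integral_Iic_eq_add_integral_Ioc hg_int hy.le
  have hsplit₁ := integral_Iic_eq_add_integral_Ioc hg₁_int hy.le
  have htot := intervalIntegral.integral_Iic_add_Ioi (b := y)
    hg_int.integrableOn hg_int.integrableOn
  have htot₁ := intervalIntegral.integral_Iic_add_Ioi (b := y)
    hg₁_int.integrableOn hg₁_int.integrableOn
  have hcross := mul_le_mul_of_nonneg_right hM₁ hT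
  have hcross₁ := mul_le_mul_of_nonneg_left hT₁ hM
  have hMT : ∫ t in Ioi y, g t = 1 / 2 - ∫ t in Ioc 0 y, g t := by linarith
  have hMT₁ : ∫ t in Ioi y, g₁ t = 1 / 2 - ∫ t in Ioc 0 y, g₁ t := by linarith
  rw [hMT] at hcross hcross₁
  rw [hMT₁] at hcross₁
  linarith

/-- Remark 1(b) of the paper (robustness): if `g₁/g` is nonincreasing on `(0, ∞)` for
symmetric densities `g₁, g`, then `G₁ ≥ G` on `[0, ∞)`; in particular
`G₁(d₀) ≥ G(d₀)` and `2·G₁(d₀) - 1 ≥ (1-α)/(1+α)`. -/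
theorem stmt5 (α : ℝ) (hα : α ∈ Set.Ioo (0:ℝ) 1)
    (g g₁ G G₁ Ginv : ℝ → ℝ)
    (hg_pos : ∀ t, 0 < g t)
    (hg₁_nonneg : ∀ t, 0 ≤ g₁ t)
    (hg_symm : ∀ t, g (-t) = g t)
    (hg₁_symm : ∀ t, g₁ (-t) = g₁ t)
    (hg_int : Integrable g) (hg₁_int : Integrable g₁)
    (hg_one : ∫ t, g t = 1) (hg₁_one : ∫ t, g₁ t = 1)
    (hG : ∀ y, G y = ∫ t in Iic y, g t)
    (hG₁ : ∀ y, G₁ y = ∫ t in Iic y, g₁ t)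
    (hGinv : ∀ p, 0 < p → p < 1 → G (Ginv p) = p)
    (hLR : AntitoneOn (fun y => g₁ y / g y) (Ioi 0))
    (d₀ : ℝ) (hd₀ : d₀ = Ginv (1/(1 + α))) :
    (∀ y : ℝ, 0 ≤ y → G y ≤ G₁ y) ∧
    G d₀ ≤ G₁ d₀ ∧
    (1 - α) / (1 + α) ≤ 2 * G₁ d₀ - 1 := by
  have hdom : ∀ y : ℝ, 0 ≤ y → G y ≤ G₁ y := fun y hy => by
    rw [hG, hG₁]
    exact integral_Iic_le_of_antitoneOn_div hg_pos hg_symm hg₁_symm hg_int hg₁_int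
      hg_one hg₁_one hLR hy
  obtain ⟨hα0, hα1⟩ := hα
  have hGd₀ : G d₀ = 1 / (1 + α) := by
    rw [hd₀]
    exact hGinv _ (by positivity) ((div_lt_one (by linarith)).2 (by linarith))
  have hd₀_nonneg : 0 ≤ d₀ := by
    by_contra! hneg
    have hle : G d₀ ≤ 1 / 2 := by
      rw [hG, ← hg_one, ← integral_Iic_zero_of_even hg_int hg_symm,
        integral_Iic_eq_add_integral_Ioc hg_int hneg.le]
      exact le_add_of_nonneg_right (integral_nonneg fun t => (hg_pos t).le)
    rw [hGd₀, div_le_div_iff₀ (by linarith) two_pos] at hle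
    linarith
  have hle := hdom d₀ hd₀_nonneg
  refine ⟨hdom, hle, ?_⟩
  have hα_eq : (1 - α) / (1 + α) = 2 * (1 / (1 + α)) - 1 := by
    field_simp
    ring
  linarith
end

section
/- Let α ∈ (0,1) and θ ≥ 0, and let X be a real random variable with density x ↦ e^{−(x−θ)}·1_{[θ,∞)}(x) (an exponential location model with location θ). Define l(x) = log(1 − α + α·e^{x}) and u(x) = x. Then: (i) for every x ≥ 0, ∫_{l(x)}^{x} e^{t−x} dt = (1−α)·(1 − e^{−x}), i.e. the interval [l(x), x] carries posterior probability 1 − α for the prior 1_{[0,∞)}(θ); (ii) the frequentist coverage satisfies P(l(X) ≤ θ ≤ u(X)) = (1−α)·(e^{θ} − 1)/(α + e^{θ} − 1); in particular the coverage equals 0 at θ = 0 and is strictly less than 1 − α for every θ ≥ 0. -/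
open Set Filter MeasureTheory

/-- The integral of a shifted exponential over an interval. -/
theorem integral_exp_sub (a b c : ℝ) :
    (∫ t in a..b, Real.exp (t - c)) = Real.exp (b - c) - Real.exp (a - c) := by
  rw [intervalIntegral.integral_comp_sub_right (fun t => Real.exp t), integral_exp]

/-- The mass that the exponential law with location `θ` gives to `[θ, b]`. -/
theorem withDensity_exp_location_Icc {θ b : ℝ} (h : θ ≤ b) :
    ((volume.withDensity (fun x => ENNReal.ofReal
      (Set.indicator (Ici θ) (fun x => Real.exp (-(x - θ))) x))) (Icc θ b)).toReal
      = 1 - Real.exp (θ - b) := by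
  have hcongr : ∫⁻ x in Icc θ b, ENNReal.ofReal
      (Set.indicator (Ici θ) (fun x => Real.exp (-(x - θ))) x)
      = ∫⁻ x in Icc θ b, ENNReal.ofReal (Real.exp (θ - x)) := by
    refine setLIntegral_congr_fun measurableSet_Icc fun x hx => ?_
    simp only [indicator_of_mem (show x ∈ Ici θ from hx.1), neg_sub]
  have hcont : Continuous fun x : ℝ => Real.exp (θ - x) := by fun_prop
  rw [withDensity_apply _ measurableSet_Icc, hcongr,
    ← integral_eq_lintegral_of_nonneg_ae (ae_of_all _ fun x => (Real.exp_pos _).le)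
      hcont.aestronglyMeasurable,
    integral_Icc_eq_integral_Ioc, ← intervalIntegral.integral_of_le h,
    intervalIntegral.integral_comp_sub_left (fun t => Real.exp t), integral_exp, sub_self,
    Real.exp_zero]

/-- Example 1 of the paper: exponential location model with density `e^{-(x-θ)} 1_{[θ,∞)}(x)`,
`θ ≥ 0`. The HPD credible interval for the uniform prior on `[0,∞)` is
`[log(1 - α + α·e^X), X]`; its posterior probability is `1 - α` and its frequentist coverage
is `(1-α)·(e^θ - 1)/(α + e^θ - 1)`, which is `0` at `θ = 0` and is always `< 1 - α`. -/
theorem stmt6 {Ω : Type*} [MeasurableSpace Ω]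
    (P : Measure Ω) [IsProbabilityMeasure P]
    (α : ℝ) (hα : α ∈ Set.Ioo (0:ℝ) 1)
    (θ : ℝ) (hθ : 0 ≤ θ)
    (X : Ω → ℝ) (hX : Measurable X)
    (hlaw : P.map X = volume.withDensity
      (fun x => ENNReal.ofReal
        (Set.indicator (Ici θ) (fun x => Real.exp (-(x - θ))) x)))
    (l : ℝ → ℝ) (hl : ∀ x, l x = Real.log (1 - α + α * Real.exp x)) :
    (∀ x : ℝ, 0 ≤ x →
        (∫ t in (l x)..x, Real.exp (t - x)) = (1 - α) * (1 - Real.exp (-x))) ∧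
    (P {ω | l (X ω) ≤ θ ∧ θ ≤ X ω}).toReal
        = (1 - α) * (Real.exp θ - 1) / (α + Real.exp θ - 1) ∧
    (θ = 0 → (P {ω | l (X ω) ≤ θ ∧ θ ≤ X ω}).toReal = 0) ∧
    (P {ω | l (X ω) ≤ θ ∧ θ ≤ X ω}).toReal < 1 - α := by
  obtain ⟨hα0, hα1⟩ := hα
  have hθ1 : 1 ≤ Real.exp θ := Real.one_le_exp hθ
  have hD : 0 < α + Real.exp θ - 1 := by linarith
  have harg : ∀ x, 0 < 1 - α + α * Real.exp x := fun x =>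
    add_pos (sub_pos.2 hα1) (mul_pos hα0 (Real.exp_pos x))
  have hcov : (P {ω | l (X ω) ≤ θ ∧ θ ≤ X ω}).toReal
      = (1 - α) * (Real.exp θ - 1) / (α + Real.exp θ - 1) := by
    set b := Real.log ((α + Real.exp θ - 1) / α)
    have hb : Real.exp b = (α + Real.exp θ - 1) / α := Real.exp_log (div_pos hD hα0)
    have hθb : θ ≤ b := by
      rw [← Real.exp_le_exp, hb, le_div_iff₀ hα0]
      nlinarith
    have hset : {ω | l (X ω) ≤ θ ∧ θ ≤ X ω} = X ⁻¹' Icc θ b := by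
      ext ω
      have hlower : l (X ω) ≤ θ ↔ X ω ≤ b := by
        rw [hl, Real.log_le_iff_le_exp (harg _), ← Real.exp_le_exp (x := X ω), hb,
          le_div_iff₀ hα0]
        constructor <;> intro h <;> linarith
      simp only [mem_ofPred_eq, mem_preimage, mem_Icc, hlower, and_comm]
    rw [hset, ← Measure.map_apply hX measurableSet_Icc, hlaw,
      withDensity_exp_location_Icc hθb, Real.exp_sub, hb]
    field_simp
    ring
  refine ⟨fun x _ => ?_, hcov, fun h => ?_, ?_⟩
  · rw [integral_exp_sub, sub_self, Real.exp_zero, Real.exp_sub, hl, Real.exp_log (harg x),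
      Real.exp_neg]
    field_simp
    ring
  · rw [hcov, h]
    simp
  · rw [hcov, div_lt_iff₀ hD]
    nlinarith
end

section
/- Let g be a continuous probability density on ℝ whose support is an interval and which is strictly unimodal with mode 0 (g is strictly increasing on supp(g) ∩ (−∞,0] and strictly decreasing on supp(g) ∩ [0,∞)), and let G be its cumulative distribution function. Then for every Δ ∈ (0,1) there exists a unique pair (γ₁, γ₂) of nonnegative real numbers with G(γ₂) − G(−γ₁) = Δ that minimizes the length a + b among all pairs (a, b) of nonnegative reals satisfying G(b) − G(−a) = Δ. Moreover, if 0 < G(0) < 1, then the minimizing pair satisfies g(−γ₁) = g(γ₂). -/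
open Set Filter MeasureTheory

open scoped Topology

theorem HasDerivAt.exists_right_gt {h : ℝ → ℝ} {d x δ : ℝ} (hh : HasDerivAt h d x)
    (hd : 0 < d) (hδ : x < δ) : ∃ s, x < s ∧ s ≤ δ ∧ h x < h s := by
  have h1 := (hasDerivAt_iff_tendsto_slope.1 hh).mono_left (nhdsGT_le_nhdsNE x)
  have h2 := h1.eventually (lt_mem_nhds hd)
  obtain ⟨s, hs, hxs⟩ := (h2.and (Ioc_mem_nhdsGT hδ)).exists
  refine ⟨s, hxs.1, hxs.2, ?_⟩
  rw [slope_def_field, div_pos_iff_of_pos_right (sub_pos.2 hxs.1)] at hs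
  linarith

theorem HasDerivAt.exists_left_gt {h : ℝ → ℝ} {d x δ : ℝ} (hh : HasDerivAt h d x)
    (hd : d < 0) (hδ : δ < x) : ∃ s, δ ≤ s ∧ s < x ∧ h x < h s := by
  have h1 := (hasDerivAt_iff_tendsto_slope.1 hh).mono_left (nhdsLT_le_nhdsNE x)
  have h2 := h1.eventually (gt_mem_nhds hd)
  obtain ⟨s, hs, hxs⟩ := (h2.and (Ico_mem_nhdsLT hδ)).exists
  refine ⟨s, hxs.1, hxs.2, ?_⟩
  rw [slope_def_field] at hs
  by_contra hc
  exact absurd (div_nonneg_of_nonpos (by linarith) (sub_nonpos.2 hxs.2.le)) (not_le.2 hs)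

/-- An interval around `0` carrying more than `Δ` can be scaled down to carry exactly `Δ`. -/
theorem exists_scaled_eq {G : ℝ → ℝ} (hG : Continuous G) {Δ a b : ℝ} (hΔ : 0 < Δ)
    (hab : Δ < G b - G (-a)) :
    ∃ u : ℝ, 0 ≤ u ∧ u < 1 ∧ G (u * b) - G (-(u * a)) = Δ := by
  have hc : Continuous fun u : ℝ => G (u * b) - G (-(u * a)) := by fun_prop
  obtain ⟨u, hu, hu'⟩ := intermediate_value_Icc zero_le_one hc.continuousOn
    (show Δ ∈ Icc _ _ by constructor <;> simp <;> linarith)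
  refine ⟨u, hu.1, lt_of_le_of_ne hu.2 ?_, hu'⟩
  rintro rfl
  simp only [one_mul] at hu'
  linarith

/-- `(a, b)` encodes a shortest interval `[-a, b]` containing `0` with `G`-content `Δ`. -/
def IsShortest (G : ℝ → ℝ) (Δ : ℝ) (p : ℝ × ℝ) : Prop :=
  0 ≤ p.1 ∧ 0 ≤ p.2 ∧ G p.2 - G (-p.1) = Δ ∧
    ∀ a b : ℝ, 0 ≤ a → 0 ≤ b → G b - G (-a) = Δ → p.1 + p.2 ≤ a + b

theorem exists_isShortest {G : ℝ → ℝ} (hG : Continuous G) {Δ a b : ℝ} (ha : 0 ≤ a) (hb : 0 ≤ b)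
    (hab : G b - G (-a) = Δ) : ∃ p, IsShortest G Δ p := by
  let K : Set (ℝ × ℝ) := Icc (0, 0) (a + b, a + b) ∩ {p | G p.2 - G (-p.1) = Δ}
  have hK : IsCompact K :=
    isCompact_Icc.inter_right (isClosed_eq (by fun_prop) continuous_const)
  have hmem : (a, b) ∈ K := by
    refine ⟨⟨⟨ha, hb⟩, ⟨?_, ?_⟩⟩, hab⟩ <;> simp [ha, hb]
  obtain ⟨p, ⟨⟨hp0, -⟩, hpΔ⟩, hmin⟩ := hK.exists_isMinOn ⟨_, hmem⟩
    (f := fun p : ℝ × ℝ => p.1 + p.2) (by fun_prop)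
  refine ⟨p, hp0.1, hp0.2, hpΔ, fun c d hc hd hcd => ?_⟩
  have hpab : p.1 + p.2 ≤ a + b := hmin hmem
  rcases le_total (c + d) (a + b) with h | h
  · refine hmin (a := (c, d)) ⟨⟨⟨hc, hd⟩, ⟨?_, ?_⟩⟩, hcd⟩ <;> simp <;> linarith
  · exact hpab.trans h

theorem IsShortest.content_le {G : ℝ → ℝ} (hG : Continuous G) {Δ : ℝ} (hΔ : 0 < Δ) {p : ℝ × ℝ}
    (hp : IsShortest G Δ p) {s : ℝ} (hs : 0 ≤ s) (hs' : s ≤ p.1 + p.2) :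
    G (p.1 + p.2 - s) - G (-s) ≤ Δ := by
  by_contra! hlt
  obtain ⟨u, hu0, hu1, hu⟩ := exists_scaled_eq hG hΔ hlt
  have hle := hp.2.2.2 _ _ (mul_nonneg hu0 hs) (mul_nonneg hu0 (sub_nonneg.2 hs')) hu
  obtain ⟨h1, h2, h3, -⟩ := hp
  have hL : 0 < p.1 + p.2 := by
    refine (add_nonneg h1 h2).lt_of_ne fun h0 => ?_
    have e1 : p.1 = 0 := by linarith
    have e2 : p.2 = 0 := by linarith
    simp [e1, e2] at h3
    linarith
  nlinarith

theorem IsShortest.density_eq {g G : ℝ → ℝ} (hG : ∀ x, HasDerivAt G (g x) x)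
    (hmode : ∀ x, g x ≤ g 0) {Δ : ℝ} (hΔ : 0 < Δ) {p : ℝ × ℝ} (hp : IsShortest G Δ p) :
    g (-p.1) = g p.2 := by
  have hGc : Continuous G := continuous_iff_continuousAt.2 fun x => (hG x).continuousAt
  have hle := fun s => hp.content_le hGc hΔ (s := s)
  obtain ⟨a, b⟩ := p
  obtain ⟨ha, hb, hab, -⟩ := hp
  simp only at *
  have hd : HasDerivAt (fun s => G (a + b - s) - G (-s)) (g (-a) - g b) a := by
    have h1 : HasDerivAt (fun s => G (a + b - s)) (-g (a + b - a)) a :=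
      (hG _).comp_const_sub (a + b) a
    have h2 : HasDerivAt (fun s => G (-s)) (-g (-a)) a := by
      simpa only [zero_sub] using (hG (0 - a)).comp_const_sub 0 a
    have h3 := h1.sub h2
    rw [add_sub_cancel_left, show -g b - -g (-a) = g (-a) - g b by ring] at h3
    exact h3
  have hval : G (a + b - a) - G (-a) = Δ := by rw [add_sub_cancel_left, hab]
  rcases lt_trichotomy (g (-a)) (g b) with h | h | h
  · have ha' : 0 < a := by
      refine ha.lt_of_ne ?_
      rintro rfl
      rw [neg_zero] at h
      exact absurd (hmode b) (not_le.2 h)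
    obtain ⟨s, hs0, hsa, hs⟩ := hd.exists_left_gt (sub_neg.2 h) ha'
    have := hle s hs0 (by linarith)
    linarith
  · exact h
  · have hb' : 0 < b := by
      refine hb.lt_of_ne ?_
      rintro rfl
      exact absurd (hmode (-a)) (not_le.2 h)
    obtain ⟨s, hsa, hsL, hs⟩ := hd.exists_right_gt (sub_pos.2 h) (show a < a + b by linarith)
    have := hle s (by linarith) hsL
    linarith

theorem zero_mem_support_of_strictMono_strictAnti {g : ℝ → ℝ} (hg : Continuous g)
    (hg_nonneg : ∀ t, 0 ≤ g t)
    (hg_incr : StrictMonoOn g (Function.support g ∩ Iic 0))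
    (hg_decr : StrictAntiOn g (Function.support g ∩ Ici 0))
    (hne : ∃ x, g x ≠ 0) : g 0 ≠ 0 := by
  intro h0
  obtain ⟨x, hx⟩ := hne
  have hxpos : 0 < g x := (hg_nonneg x).lt_of_ne' hx
  rcases le_total 0 x with h | h
  · obtain ⟨y, hy, hgy⟩ := intermediate_value_Icc h hg.continuousOn
      (show g x / 2 ∈ Icc _ _ by constructor <;> linarith)
    have hyx : y < x := hy.2.lt_of_ne (by rintro rfl; linarith)
    have := hg_decr ⟨by rw [Function.mem_support]; linarith, hy.1⟩ ⟨hx, h⟩ hyx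
    linarith
  · obtain ⟨y, hy, hgy⟩ := intermediate_value_Icc' h hg.continuousOn
      (show g x / 2 ∈ Icc _ _ by constructor <;> linarith)
    have hyx : x < y := hy.1.lt_of_ne (by rintro rfl; linarith)
    have := hg_incr ⟨hx, h⟩ ⟨by rw [Function.mem_support]; linarith, hy.2⟩ hyx
    linarith

/-- Definition 2 of the paper is well posed: for a continuous strictly unimodal (at 0)
density `g` with interval support and cdf `G`, and any `Δ ∈ (0,1)`, there is a unique pair
`(γ₁, γ₂)` of nonnegative reals with `G(γ₂) - G(-γ₁) = Δ` minimizing the length `γ₁ + γ₂`;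
moreover if `0 < G(0) < 1` this minimizing pair satisfies `g(-γ₁) = g(γ₂)`. -/
theorem stmt7 (g G : ℝ → ℝ)
    (hg_cont : Continuous g)
    (hg_nonneg : ∀ t, 0 ≤ g t)
    (hg_supp : (Function.support g).OrdConnected)
    (hg_incr : StrictMonoOn g (Function.support g ∩ Iic 0))
    (hg_decr : StrictAntiOn g (Function.support g ∩ Ici 0))
    (hg_int : Integrable g)
    (hg_one : ∫ t, g t = 1)
    (hG : ∀ y, G y = ∫ t in Iic y, g t) :
    ∀ Δ : ℝ, 0 < Δ → Δ < 1 →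
      (∃! p : ℝ × ℝ,
        0 ≤ p.1 ∧ 0 ≤ p.2 ∧ G p.2 - G (-p.1) = Δ ∧
          ∀ a b : ℝ, 0 ≤ a → 0 ≤ b → G b - G (-a) = Δ → p.1 + p.2 ≤ a + b) ∧
      (0 < G 0 → G 0 < 1 →
        ∀ p : ℝ × ℝ,
          (0 ≤ p.1 ∧ 0 ≤ p.2 ∧ G p.2 - G (-p.1) = Δ ∧
            ∀ a b : ℝ, 0 ≤ a → 0 ≤ b → G b - G (-a) = Δ → p.1 + p.2 ≤ a + b) →
          g (-p.1) = g p.2) := by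
  intro Δ hΔ hΔ1
  have h0 : g 0 ≠ 0 := by
    refine zero_mem_support_of_strictMono_strictAnti hg_cont hg_nonneg hg_incr hg_decr ?_
    by_contra! h
    simp [h] at hg_one
  have hanti : ∀ x y, 0 ≤ x → x < y → g y ≠ 0 → g y < g x := fun x y hx hxy hy =>
    hg_decr ⟨hg_supp.out h0 hy ⟨hx, hxy.le⟩, hx⟩ ⟨hy, hx.trans hxy.le⟩ hxy
  have hmono : ∀ x y, y ≤ 0 → x < y → g x ≠ 0 → g x < g y := fun x y hy hxy hx =>
    hg_incr ⟨hx, hxy.le.trans hy⟩ ⟨hg_supp.out hx h0 ⟨hxy.le, hy⟩, hy⟩ hxy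
  have hmode : ∀ x, g x ≤ g 0 := by
    intro x
    by_cases hx : g x = 0
    · exact hx.le.trans (hg_nonneg 0)
    rcases lt_trichotomy x 0 with h | h | h
    · exact (hmono x 0 le_rfl h hx).le
    · rw [h]
    · exact (hanti 0 x le_rfl h hx).le
  have hGsub : ∀ x y, G y - G x = ∫ t in x..y, g t := fun x y => by
    rw [hG, hG, intervalIntegral.integral_Iic_sub_Iic hg_int.integrableOn hg_int.integrableOn]
  have hGd : ∀ x, HasDerivAt G (g x) x := fun x => by
    have h := (hg_cont.integral_hasStrictDerivAt 0 x).hasDerivAt.const_add (G 0)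
    refine h.congr_of_eventuallyEq (.of_forall fun y => ?_)
    simp only [← hGsub 0 y]
    ring
  have hGc : Continuous G := continuous_iff_continuousAt.2 fun x => (hGd x).continuousAt
  have heq : ∀ p, IsShortest G Δ p → g (-p.1) = g p.2 := fun p hp =>
    hp.density_eq hGd hmode hΔ
  refine ⟨?_, fun _ _ p hp => heq p hp⟩
  have hlim : Tendsto (fun n : ℝ => G n - G (-n)) atTop (𝓝 1) := by
    simp only [hGsub, ← hg_one]
    exact intervalIntegral_tendsto_integral hg_int tendsto_neg_atTop_atBot tendsto_id
  obtain ⟨n, hn, hn0⟩ := ((hlim.eventually (lt_mem_nhds hΔ1)).and (eventually_ge_atTop 0)).exists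
  obtain ⟨u, hu0, -, hu⟩ := exists_scaled_eq hGc hΔ hn
  obtain ⟨p, hp⟩ := exists_isShortest hGc (mul_nonneg hu0 hn0) (mul_nonneg hu0 hn0) hu
  have hle : ∀ p q, IsShortest G Δ p → IsShortest G Δ q → p.1 ≤ q.1 := by
    intro p q hp hq
    by_contra! hlt
    have hsum : p.1 + p.2 = q.1 + q.2 :=
      le_antisymm (hp.2.2.2 _ _ hq.1 hq.2.1 hq.2.2.1) (hq.2.2.2 _ _ hp.1 hp.2.1 hp.2.2.1)
    have hlt2 : p.2 < q.2 := by linarith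
    have hep := heq p hp
    have heq' := heq q hq
    have hq1 := hq.1
    have hp2 := hp.2.1
    have hleft := hmono (-p.1) (-q.1) (by linarith) (by linarith)
    have hright := hanti p.2 q.2 hp2 hlt2
    have hzero : g q.2 = 0 := by
      by_contra hne
      have h1 := hright hne
      have h2 := hleft (by rw [hep]; exact ((hg_nonneg _).trans_lt h1).ne')
      linarith
    have hfull : ∫ t in (-q.1)..q.2, g t = 1 := by
      rw [intervalIntegral.integral_of_le (by linarith [hq.2.1]), ← hg_one]
      refine setIntegral_eq_integral_of_forall_compl_eq_zero fun x hx => ?_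
      by_contra hne
      have hxpos := (hg_nonneg x).lt_of_ne' hne
      rcases le_or_gt x (-q.1) with h | h
      · rcases h.eq_or_lt with rfl | h
        · exact hne (heq'.trans hzero)
        · have := hmono x (-q.1) (by linarith) h hne
          linarith
      · have := hanti q.2 x hq.2.1 (not_le.1 fun h' => hx ⟨h, h'⟩) hne
        linarith
    have := hq.2.2.1
    rw [hGsub, hfull] at this
    linarith
  refine ⟨p, hp, fun q hq => ?_⟩
  have h1 : q.1 = p.1 := le_antisymm (hle q p hq hp) (hle p q hp hq)
  have h2 := hp.2.2.2 _ _ hq.1 hq.2.1 hq.2.2.1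
  have h3 := hq.2.2.2 _ _ hp.1 hp.2.1 hp.2.2.1
  exact Prod.ext h1 (by linarith)
end

section
/- The following characterizations hold: (i) there exists a point y₀ with −y₀ in the interior of supp(g) such that U_{G,α}(y₀) = 0 if and only if 0 < G(0) < 1; (ii) U_{G,α}(y) ≥ 0 for every y with −y in the interior of supp(g) if and only if G(0) = 0; (iii) U_{G,α}(y) ≤ 0 for every y with −y in the interior of supp(g) if and only if G(0) = 1. -/
open Set Filter MeasureTheory Topology

/-- `G` is a distribution function with derivative `g`, where `g` is strictly unimodal with
mode `0`: on its support, it decreases strictly away from `0` on either side. -/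
structure IsUnimodalCDF (g G : ℝ → ℝ) : Prop where
  continuous : Continuous g
  nonneg : ∀ t, 0 ≤ g t
  pos_zero : 0 < g 0
  lt_of_pos_left : ∀ {x y}, x < y → y ≤ 0 → 0 < g x → g x < g y
  lt_of_pos_right : ∀ {x y}, 0 ≤ x → x < y → 0 < g y → g y < g x
  hasDerivAt : ∀ x, HasDerivAt G (g x) x
  tendsto_atBot : Tendsto G atBot (𝓝 0)
  tendsto_atTop : Tendsto G atTop (𝓝 1)

/-- `[-a, b]` is a shortest interval containing `0` whose probability under `G` is `Δ`. -/
def IsShortestInterval (G : ℝ → ℝ) (Δ a b : ℝ) : Prop :=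
  0 ≤ a ∧ 0 ≤ b ∧ G b - G (-a) = Δ ∧
    ∀ a' b' : ℝ, 0 ≤ a' → 0 ≤ b' → G b' - G (-a') = Δ → a + b ≤ a' + b'

/-- A strictly unimodal function which is not identically zero is positive at its mode. -/
theorem pos_zero_of_strictMonoOn_of_strictAntiOn {g : ℝ → ℝ} (hc : Continuous g)
    (h0 : ∀ t, 0 ≤ g t) (hi : StrictMonoOn g (Function.support g ∩ Iic 0))
    (hd : StrictAntiOn g (Function.support g ∩ Ici 0)) {z : ℝ} (hz : g z ≠ 0) : 0 < g 0 := by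
  by_contra hn
  have h00 : g 0 = 0 := le_antisymm (not_lt.1 hn) (h0 0)
  have hzp : 0 < g z := (h0 z).lt_of_ne' hz
  have hmem : g z / 2 ∈ Icc (g 0) (g z) := by rw [h00]; constructor <;> linarith
  rcases le_total 0 z with h | h
  · obtain ⟨w, hw, hgw⟩ := intermediate_value_Icc h hc.continuousOn hmem
    have hwz : w < z := hw.2.lt_of_ne (by rintro rfl; linarith)
    have := hd ⟨by rw [Function.mem_support, hgw]; positivity, hw.1⟩ ⟨hz, h⟩ hwz
    linarith
  · obtain ⟨w, hw, hgw⟩ := intermediate_value_Icc' h hc.continuousOn hmem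
    have hwz : z < w := hw.1.lt_of_ne (by rintro rfl; linarith)
    have := hi ⟨hz, h⟩ ⟨by rw [Function.mem_support, hgw]; positivity, hw.2⟩ hwz
    linarith

theorem IsUnimodalCDF.of_density {g G : ℝ → ℝ} (hc : Continuous g) (h0 : ∀ t, 0 ≤ g t)
    (hs : (Function.support g).OrdConnected)
    (hi : StrictMonoOn g (Function.support g ∩ Iic 0))
    (hd : StrictAntiOn g (Function.support g ∩ Ici 0))
    (hint : Integrable g) (hone : ∫ t, g t = 1) (hG : ∀ y, G y = ∫ t in Iic y, g t) :
    IsUnimodalCDF g G := by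
  obtain rfl : G = fun y => ∫ t in Iic y, g t := funext hG
  have hp : 0 < g 0 := by
    obtain ⟨z, hz⟩ : ∃ z, g z ≠ 0 := by
      by_contra! hn
      simp [hn] at hone
    exact pos_zero_of_strictMonoOn_of_strictAntiOn hc h0 hi hd hz
  refine ⟨hc, h0, hp, fun {x y} hxy hy hgx => ?_, fun {x y} hx hxy hgy => ?_, fun x => ?_,
    tendsto_integral_Iic_zero tendsto_id, ?_⟩
  · exact hi ⟨hgx.ne', hxy.le.trans hy⟩ ⟨hs.out hgx.ne' hp.ne' ⟨hxy.le, hy⟩, hy⟩ hxy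
  · exact hd ⟨hs.out hp.ne' hgy.ne' ⟨hx, hxy.le⟩, hx⟩ ⟨hgy.ne', hx.trans hxy.le⟩ hxy
  · have h := ((hc.integral_hasStrictDerivAt 0 x).hasDerivAt).const_add (∫ t in Iic (0 : ℝ), g t)
    refine h.congr_of_eventuallyEq (Eventually.of_forall fun y => ?_)
    have := intervalIntegral.integral_Iic_sub_Iic (a := 0) (b := y) hint.integrableOn
      hint.integrableOn
    simp only
    linarith
  · rw [← hone]
    exact (aecover_Iic tendsto_id).integral_tendsto_of_countably_generated hint

namespace IsUnimodalCDF

variable {g G : ℝ → ℝ} {x y z : ℝ}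

theorem lt_left (h : IsUnimodalCDF g G) (hxy : x < y) (hy : y ≤ 0) (hgy : 0 < g y) :
    g x < g y := by
  rcases (h.nonneg x).eq_or_lt with hx | hx
  · rwa [← hx]
  · exact h.lt_of_pos_left hxy hy hx

theorem lt_right (h : IsUnimodalCDF g G) (hx : 0 ≤ x) (hxy : x < y) (hgx : 0 < g x) :
    g y < g x := by
  rcases (h.nonneg y).eq_or_lt with hy | hy
  · rwa [← hy]
  · exact h.lt_of_pos_right hx hxy hy

theorem le_left (h : IsUnimodalCDF g G) (hxy : x ≤ y) (hy : y ≤ 0) : g x ≤ g y := by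
  rcases hxy.eq_or_lt with rfl | hxy
  · rfl
  rcases (h.nonneg x).eq_or_lt with hx | hx
  · exact hx ▸ h.nonneg y
  · exact (h.lt_of_pos_left hxy hy hx).le

theorem le_right (h : IsUnimodalCDF g G) (hx : 0 ≤ x) (hxy : x ≤ y) : g y ≤ g x := by
  rcases hxy.eq_or_lt with rfl | hxy
  · rfl
  rcases (h.nonneg y).eq_or_lt with hy | hy
  · exact hy ▸ h.nonneg x
  · exact (h.lt_of_pos_right hx hxy hy).le

theorem min_le (h : IsUnimodalCDF g G) (hxy : x ≤ y) (hyz : y ≤ z) : min (g x) (g z) ≤ g y := by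
  rcases le_total y 0 with hy | hy
  · exact (min_le_left _ _).trans (h.le_left hxy hy)
  · exact (min_le_right _ _).trans (h.le_right hy hyz)

theorem continuous_cdf (h : IsUnimodalCDF g G) : Continuous G :=
  continuous_iff_continuousAt.2 fun x => (h.hasDerivAt x).continuousAt

theorem exists_sub_eq (h : IsUnimodalCDF g G) (hxy : x < y) :
    ∃ ξ, x < ξ ∧ ξ < y ∧ G y - G x = g ξ * (y - x) := by
  obtain ⟨ξ, hξ, he⟩ := exists_hasDerivAt_eq_slope G g hxy h.continuous_cdf.continuousOn
    fun x _ => h.hasDerivAt x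
  exact ⟨ξ, hξ.1, hξ.2, by rw [he, div_mul_cancel₀ _ (sub_pos.2 hxy).ne']⟩

theorem monotone (h : IsUnimodalCDF g G) : Monotone G := by
  intro x y hxy
  rcases hxy.eq_or_lt with rfl | hxy
  · rfl
  obtain ⟨ξ, -, -, hξ⟩ := h.exists_sub_eq hxy
  have := mul_nonneg (h.nonneg ξ) (sub_pos.2 hxy).le
  linarith

theorem cdf_nonneg (h : IsUnimodalCDF g G) (x : ℝ) : 0 ≤ G x :=
  h.monotone.le_of_tendsto h.tendsto_atBot x

theorem cdf_le_one (h : IsUnimodalCDF g G) (x : ℝ) : G x ≤ 1 :=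
  h.monotone.ge_of_tendsto h.tendsto_atTop x

theorem cdf_lt_of_pos_left (h : IsUnimodalCDF g G) (hx : 0 < g x) (hxy : x < y) : G x < G y := by
  refine (h.monotone hxy.le).lt_of_ne fun he => ?_
  have hev : ∀ᶠ w in 𝓝[>] x, 0 < g w :=
    ((h.continuous.tendsto x).mono_left nhdsWithin_le_nhds).eventually_const_lt hx
  obtain ⟨w, hw, hmem⟩ := (hev.and (Ioo_mem_nhdsGT hxy)).exists
  obtain ⟨ξ, h1, h2, hξ⟩ := h.exists_sub_eq hmem.1
  have hpos : 0 < g ξ := (lt_min hx hw).trans_le (h.min_le h1.le h2.le)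
  have := mul_pos hpos (sub_pos.2 hmem.1)
  have := h.monotone hmem.2.le
  linarith

theorem cdf_lt_of_pos_right (h : IsUnimodalCDF g G) (hy : 0 < g y) (hxy : x < y) : G x < G y := by
  refine (h.monotone hxy.le).lt_of_ne fun he => ?_
  have hev : ∀ᶠ w in 𝓝[<] y, 0 < g w :=
    ((h.continuous.tendsto y).mono_left nhdsWithin_le_nhds).eventually_const_lt hy
  obtain ⟨w, hw, hmem⟩ := (hev.and (Ioo_mem_nhdsLT hxy)).exists
  obtain ⟨ξ, h1, h2, hξ⟩ := h.exists_sub_eq hmem.2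
  have hpos : 0 < g ξ := (lt_min hw hy).trans_le (h.min_le h1.le h2.le)
  have := mul_pos hpos (sub_pos.2 hmem.2)
  have := h.monotone hmem.1.le
  linarith

theorem cdf_pos (h : IsUnimodalCDF g G) (hx : 0 < g x) : 0 < G x :=
  (h.cdf_nonneg (x - 1)).trans_lt (h.cdf_lt_of_pos_right hx (by linarith))

theorem cdf_lt_one (h : IsUnimodalCDF g G) (hx : 0 < g x) : G x < 1 :=
  (h.cdf_lt_of_pos_left hx (lt_add_one x)).trans_le (h.cdf_le_one _)

theorem pos_of_cdf_mem_Ioo (h : IsUnimodalCDF g G) (hx : G x ∈ Ioo 0 1) : 0 < g x := by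
  refine (h.nonneg x).lt_of_ne fun hgx => ?_
  rcases le_total 0 x with h0 | h0
  · obtain ⟨y, hy, hxy⟩ := ((h.tendsto_atTop.eventually_const_lt hx.2).and
      (eventually_gt_atTop x)).exists
    obtain ⟨ξ, h1, -, hξ⟩ := h.exists_sub_eq hxy
    have : g ξ = 0 := le_antisymm (hgx ▸ h.le_right h0 h1.le) (h.nonneg ξ)
    rw [this] at hξ
    linarith
  · obtain ⟨y, hy, hxy⟩ := ((h.tendsto_atBot.eventually_lt_const hx.1).and
      (eventually_lt_atBot x)).exists
    obtain ⟨ξ, -, h1, hξ⟩ := h.exists_sub_eq hxy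
    have : g ξ = 0 := le_antisymm (hgx ▸ h.le_left h1.le h0) (h.nonneg ξ)
    rw [this] at hξ
    linarith

theorem lt_of_cdf_lt (h : IsUnimodalCDF g G) (hxy : G x < G y) : x < y :=
  lt_of_not_ge fun hn => (h.monotone hn).not_gt hxy

/-- The quantile function: a right inverse of `G` on `(0, 1)`, continuous there. -/
theorem exists_quantile (h : IsUnimodalCDF g G) :
    ∃ Q : ℝ → ℝ, (∀ p ∈ Ioo (0 : ℝ) 1, G (Q p) = p) ∧ ∀ p ∈ Ioo (0 : ℝ) 1, ContinuousAt Q p := by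
  have hex : ∀ p : ℝ, ∃ y, p ∈ Ioo (0 : ℝ) 1 → G y = p := fun p => by
    by_cases hp : p ∈ Ioo (0 : ℝ) 1
    · obtain ⟨a, ha⟩ := (h.tendsto_atBot.eventually_lt_const hp.1).exists
      obtain ⟨b, hb⟩ := (h.tendsto_atTop.eventually_const_lt hp.2).exists
      obtain ⟨y, hy⟩ := mem_range_of_exists_le_of_exists_ge h.continuous_cdf ⟨a, ha.le⟩ ⟨b, hb.le⟩
      exact ⟨y, fun _ => hy⟩
    · exact ⟨0, fun hp' => absurd hp' hp⟩
  choose Q hQ using hex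
  refine ⟨Q, hQ, fun p hp => ?_⟩
  have hmono : StrictMonoOn Q (Ioo 0 1) := fun p hp q hq hpq =>
    h.lt_of_cdf_lt (by rwa [hQ p hp, hQ q hq])
  refine hmono.continuousAt_of_image_mem_nhds (Ioo_mem_nhds hp.1 hp.2) ?_
  have hpos : 0 < g (Q p) := h.pos_of_cdf_mem_Ioo (by rwa [hQ p hp])
  filter_upwards [(h.continuous.tendsto _).eventually_const_lt hpos] with z hz
  have hGz : G z ∈ Ioo 0 1 := ⟨h.cdf_pos hz, h.cdf_lt_one hz⟩
  refine ⟨G z, hGz, ?_⟩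
  rcases lt_trichotomy (Q (G z)) z with hlt | heq | hlt
  · exact absurd (hQ _ hGz) (h.cdf_lt_of_pos_right hz hlt).ne
  · exact heq
  · exact absurd (hQ _ hGz) (h.cdf_lt_of_pos_left hz hlt).ne'

theorem exists_neg_pos_lt (h : IsUnimodalCDF g G) {m : ℝ} (hm : 0 < m) :
    ∃ x < 0, 0 < g x ∧ g x < m := by
  obtain ⟨k, hk0, hk, hkm⟩ : ∃ k, 0 < k ∧ k < g 0 ∧ k < m := by
    have := lt_min h.pos_zero hm
    obtain ⟨k, h1, h2⟩ := exists_between this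
    exact ⟨k, h1, h2.trans_le (min_le_left _ _), h2.trans_le (min_le_right _ _)⟩
  obtain ⟨ξ, -, hξ, he⟩ := h.exists_sub_eq (x := -(1 / k)) (y := 0)
    (neg_lt_zero.2 (by positivity))
  have hle : g ξ * (1 / k) ≤ 1 := by
    have := h.cdf_le_one 0
    have := h.cdf_nonneg (-(1 / k))
    linarith
  rw [mul_one_div, div_le_one hk0] at hle
  obtain ⟨x, hx, hgx⟩ := intermediate_value_Icc hξ.le h.continuous.continuousOn ⟨hle, hk.le⟩
  exact ⟨x, hx.2.lt_of_ne (by rintro rfl; linarith), hgx ▸ hk0, hgx ▸ hkm⟩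

/-- An interval around `0` with equal densities at its endpoints has the same left endpoint as
the shortest interval of the same probability. -/
theorem eq_neg_of_isShortestInterval (h : IsUnimodalCDF g G) {Δ a b c : ℝ}
    (hx : x < 0) (hb : 0 < b) (hgx : 0 < g x) (he : g x = g b) (hΔ : G b - G x = Δ)
    (hs : IsShortestInterval G Δ a c) : a = -x := by
  obtain ⟨ha0, hc0, hac, hmin⟩ := hs
  have hlen := hmin (-x) b (by linarith) hb.le (by rwa [neg_neg])
  rcases lt_trichotomy (-a) x with hlt | heq | hlt
  · have hc : c < b := by linarith
    obtain ⟨ξ, -, h2, hξ⟩ := h.exists_sub_eq hlt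
    obtain ⟨η, h3, h4, hη⟩ := h.exists_sub_eq hc
    have h5 := h.lt_left h2 hx.le hgx
    have h6 : g b ≤ g η := h.le_right (by linarith) h4.le
    nlinarith [h.nonneg η]
  · linarith
  · obtain ⟨ξ, h1, h2, hξ⟩ := h.exists_sub_eq hlt
    have h5 : g x < g ξ := h.lt_of_pos_left h1 (by linarith) hgx
    have h7 : G b < G c := by
      have := h.cdf_lt_of_pos_left hgx hlt
      linarith
    have hc : b < c := h.lt_of_cdf_lt h7
    obtain ⟨η, h3, h4, hη⟩ := h.exists_sub_eq hc
    have h6 : g η ≤ g b := h.le_right hb.le h3.le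
    nlinarith

/-- If the density is smaller at the left endpoint of an interval than at the right one, moving
both endpoints to the right yields a strictly shorter interval of the same probability. -/
theorem exists_shorter (h : IsUnimodalCDF g G) {b : ℝ} (hx : x < 0) (hlt : g x < g b) :
    ∃ x' b', x' ≤ 0 ∧ b ≤ b' ∧ G b' - G x' = G b - G x ∧ b' - x' < b - x := by
  obtain ⟨k, hk1, hk2⟩ := exists_between hlt
  have e1 := (h.continuous.tendsto x).eventually_lt_const hk1
  have e2 := (h.continuous.tendsto b).eventually_const_lt hk2
  obtain ⟨r, hr, hr'⟩ := Metric.eventually_nhds_iff.1 e1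
  obtain ⟨s, hs, hs'⟩ := Metric.eventually_nhds_iff.1 e2
  obtain ⟨δ, hδ, hδ'⟩ := exists_between (lt_min (lt_min hr hs) (neg_pos.2 hx))
  obtain ⟨⟨hδr, hδs⟩, hδx⟩ : (δ < r ∧ δ < s) ∧ δ < -x := by simpa only [lt_min_iff] using hδ'
  obtain ⟨ξ, h1, h2, hξ⟩ := h.exists_sub_eq (lt_add_of_pos_right x hδ)
  obtain ⟨η, h3, h4, hη⟩ := h.exists_sub_eq (lt_add_of_pos_right b hδ)
  have hgξ : g ξ < k := hr' (by rw [Real.dist_eq, abs_lt]; constructor <;> linarith)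
  have hgη : k < g η := hs' (by rw [Real.dist_eq, abs_lt]; constructor <;> linarith)
  have hineq : G (x + δ) - G x < G (b + δ) - G b := by rw [hξ, hη]; nlinarith
  obtain ⟨b', hb', hGb'⟩ := intermediate_value_Icc (lt_add_of_pos_right b hδ).le
    h.continuous_cdf.continuousOn (show G b + (G (x + δ) - G x) ∈ Icc (G b) (G (b + δ)) from
      ⟨by linarith [h.monotone (lt_add_of_pos_right x hδ).le], by linarith⟩)
  have : b' < b + δ := h.lt_of_cdf_lt (by linarith)
  exact ⟨x + δ, b', by linarith, hb'.1, by linarith, by linarith⟩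

/-- If the density is smaller at the left endpoint of an interval than at the right one, the
shortest interval of the same probability starts strictly further to the right. -/
theorem lt_neg_of_isShortestInterval (h : IsUnimodalCDF g G) {Δ a b c : ℝ}
    (hx : x < 0) (hlt : g x < g b) (hΔ : G b - G x = Δ)
    (hs : IsShortestInterval G Δ a c) : a < -x := by
  obtain ⟨ha0, hc0, hac, hmin⟩ := hs
  by_contra! hn
  have hgb : 0 < g b := (h.nonneg x).trans_lt hlt
  have hax : -a ≤ x := by linarith
  have hcb : c ≤ b := by
    by_contra! hbc
    have := h.cdf_lt_of_pos_left hgb hbc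
    have := h.monotone hax
    linarith
  rcases hax.eq_or_lt with heq | hax
  · have hc : c = b := by
      by_contra hne
      have := h.cdf_lt_of_pos_right hgb (hcb.lt_of_ne hne)
      rw [heq] at hac
      linarith
    obtain ⟨x', b', hx', hb', hG', hlen⟩ := h.exists_shorter hx hlt
    have := hmin (-x') b' (by linarith) (by linarith) (by rw [neg_neg]; linarith)
    linarith
  · have hlen := hmin (-x) b (by linarith) (hc0.trans hcb) (by rwa [neg_neg])
    have hc : c < b := by linarith
    obtain ⟨ξ, -, h2, hξ⟩ := h.exists_sub_eq hax
    obtain ⟨η, h3, h4, hη⟩ := h.exists_sub_eq hc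
    have h5 := h.le_left h2.le hx.le
    have h6 : g b ≤ g η := h.le_right (by linarith) h4.le
    nlinarith [h.nonneg ξ]

/-- Left endpoints `x` at which the upper endpoint `b` determined by
`G b - G x = (1 - α) * (1 - G x)` has higher, respectively the same, density. -/
theorem exists_lt_and_exists_eq (h : IsUnimodalCDF g G) {α : ℝ} (hα : α ∈ Ioo (0 : ℝ) 1) :
    (∃ x b, x < 0 ∧ 0 < g x ∧ g x < g b ∧ G b - G x = (1 - α) * (1 - G x)) ∧
    ∃ x b, x < 0 ∧ 0 < b ∧ 0 < g x ∧ g x = g b ∧ G b - G x = (1 - α) * (1 - G x) := by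
  obtain ⟨hα0, hα1⟩ := hα
  obtain ⟨Q, hQ, hQc⟩ := h.exists_quantile
  have hG0 := h.cdf_lt_one h.pos_zero
  set p : ℝ → ℝ := fun x => 1 - α + α * G x with hp
  have hpmem : ∀ x ≤ 0, p x ∈ Ioo 0 1 := fun x hx => by
    have h1 := h.monotone hx
    have h2 := h.cdf_nonneg x
    constructor <;> simp only [hp] <;> nlinarith
  have hp0 : 1 - α ∈ Ioo 0 1 := ⟨by linarith, by linarith⟩
  have hposQ : ∀ q ∈ Ioo (0 : ℝ) 1, 0 < g (Q q) := fun q hq =>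
    h.pos_of_cdf_mem_Ioo (by rwa [hQ q hq])
  have hQle : ∀ q ∈ Ioo (0 : ℝ) 1, ∀ r ∈ Ioo (0 : ℝ) 1, q ≤ r → Q q ≤ Q r := by
    intro q hq r hr hqr
    by_contra! hlt
    have := h.cdf_lt_of_pos_right (hposQ q hq) hlt
    rw [hQ q hq, hQ r hr] at this
    linarith
  have hprob : ∀ x ≤ 0, G (Q (p x)) - G x = (1 - α) * (1 - G x) := fun x hx => by
    rw [hQ _ (hpmem x hx)]
    ring
  obtain ⟨x₀, hx₀, hgx₀, hlow⟩ := h.exists_neg_pos_lt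
    (lt_min (hposQ _ hp0) (hposQ _ (hpmem 0 le_rfl)))
  have hlt₀ : g x₀ < g (Q (p x₀)) := by
    have hm := h.monotone hx₀.le
    have hn := h.cdf_nonneg x₀
    refine hlow.trans_le (h.min_le (hQle _ hp0 _ (hpmem _ hx₀.le) ?_)
      (hQle _ (hpmem _ hx₀.le) _ (hpmem 0 le_rfl) ?_)) <;> simp only [hp] <;> nlinarith
  refine ⟨⟨x₀, Q (p x₀), hx₀, hgx₀, hlt₀, hprob x₀ hx₀.le⟩, ?_⟩
  have hcont : ContinuousOn (fun x => g x - g (Q (p x))) (Icc x₀ 0) := fun x hx =>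
    (h.continuous.continuousAt.sub (h.continuous.continuousAt.comp
      (ContinuousAt.comp (f := p) (hQc _ (hpmem x hx.2))
        (continuous_const.add (continuous_const.mul h.continuous_cdf)).continuousAt)))
      |>.continuousWithinAt
  have hlt_Q : ∀ x ≤ 0, x < Q (p x) := fun x hx => h.lt_of_cdf_lt (by
    have := h.monotone hx
    have := hprob x hx
    nlinarith)
  obtain ⟨x, hx, hzero⟩ := intermediate_value_Ioo hx₀.le hcont (show (0 : ℝ) ∈ Ioo _ _ from
    ⟨sub_neg.2 hlt₀, sub_pos.2 (h.lt_right le_rfl (hlt_Q 0 le_rfl) h.pos_zero)⟩)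
  have hgx : g x = g (Q (p x)) := sub_eq_zero.1 hzero
  have hgpos : 0 < g x := hgx ▸ hposQ _ (hpmem x hx.2.le)
  refine ⟨x, Q (p x), hx.2, ?_, hgpos, hgx, hprob x hx.2.le⟩
  by_contra! hb
  exact (h.lt_of_pos_left (hlt_Q x hx.2.le) hb hgpos).ne hgx

end IsUnimodalCDF

/-- Lemma 3 of the paper: the classes `𝒞₁`, `𝒞₂`, `𝒞₃` defined through the sign behavior of
`U_{G,α}(y) = -y + γ₁((1-α)(1-G(-y)))` coincide with `{G : 0 < G(0) < 1}`,
`{G : G(0) = 0}` and `{G : G(0) = 1}` respectively. -/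
theorem stmt8 (α : ℝ) (hα : α ∈ Set.Ioo (0:ℝ) 1)
    (g G : ℝ → ℝ)
    (hg_cont : Continuous g)
    (hg_nonneg : ∀ t, 0 ≤ g t)
    (hg_supp : (Function.support g).OrdConnected)
    (hg_incr : StrictMonoOn g (Function.support g ∩ Iic 0))
    (hg_decr : StrictAntiOn g (Function.support g ∩ Ici 0))
    (hg_int : Integrable g)
    (hg_one : ∫ t, g t = 1)
    (hG : ∀ y, G y = ∫ t in Iic y, g t)
    (γ₁ γ₂ : ℝ → ℝ)
    (hγ : ∀ Δ : ℝ, 0 < Δ → Δ < 1 →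
      0 ≤ γ₁ Δ ∧ 0 ≤ γ₂ Δ ∧ G (γ₂ Δ) - G (-(γ₁ Δ)) = Δ ∧
        ∀ a b : ℝ, 0 ≤ a → 0 ≤ b → G b - G (-a) = Δ → γ₁ Δ + γ₂ Δ ≤ a + b)
    (U : ℝ → ℝ)
    (hU : ∀ y, U y = -y + γ₁ ((1 - α) * (1 - G (-y)))) :
    ((∃ y₀ : ℝ, -y₀ ∈ interior (Function.support g) ∧ U y₀ = 0) ↔
        (0 < G 0 ∧ G 0 < 1)) ∧
    ((∀ y : ℝ, -y ∈ interior (Function.support g) → 0 ≤ U y) ↔ G 0 = 0) ∧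
    ((∀ y : ℝ, -y ∈ interior (Function.support g) → U y ≤ 0) ↔ G 0 = 1) := by
  have h := IsUnimodalCDF.of_density hg_cont hg_nonneg hg_supp hg_incr hg_decr hg_int hg_one hG
  have hshort : ∀ x, 0 < g x → IsShortestInterval G ((1 - α) * (1 - G x))
      (γ₁ ((1 - α) * (1 - G x))) (γ₂ ((1 - α) * (1 - G x))) := fun x hx => by
    have h0 := h.cdf_pos hx
    have h1 := h.cdf_lt_one hx
    have hα0 := hα.1
    have hα1 := hα.2
    exact hγ _ (mul_pos (by linarith) (by linarith)) (by nlinarith)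
  have hmem : ∀ x, 0 < g x → - -x ∈ interior (Function.support g) := fun x hx => by
    rw [hg_cont.isOpen_support.interior_eq, neg_neg]
    exact hx.ne'
  have hU' : ∀ x, U (-x) = x + γ₁ ((1 - α) * (1 - G x)) := fun x => by rw [hU, neg_neg]
  have hG0 : 0 < G 0 := h.cdf_pos h.pos_zero
  have hG1 : G 0 < 1 := h.cdf_lt_one h.pos_zero
  obtain ⟨⟨x₁, b₁, hx₁, hgx₁, hlt₁, hb₁⟩, x₂, b₂, hx₂, hb₂, hgx₂, heq₂, hΔ₂⟩ :=
    h.exists_lt_and_exists_eq hα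
  refine ⟨⟨fun _ => ⟨hG0, hG1⟩, fun _ => ⟨-x₂, hmem _ hgx₂, ?_⟩⟩,
    ⟨fun hall => ?_, fun h0 => absurd h0 hG0.ne'⟩, ⟨fun hall => ?_, fun h1 => absurd h1 hG1.ne⟩⟩
  · rw [hU', h.eq_neg_of_isShortestInterval hx₂ hb₂ hgx₂ heq₂ hΔ₂ (hshort _ hgx₂),
      add_neg_cancel]
  · have hneg := h.lt_neg_of_isShortestInterval hx₁ hlt₁ hb₁ (hshort _ hgx₁)
    have := hall _ (hmem _ hgx₁)
    rw [hU'] at this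
    linarith
  · obtain ⟨x, hgx, hx⟩ : ∃ x, 0 < g x ∧ 0 < x :=
      (((hg_cont.tendsto 0).mono_left nhdsWithin_le_nhds |>.eventually_const_lt h.pos_zero).and
        (self_mem_nhdsWithin (s := Ioi (0 : ℝ)))).exists
    have := hall _ (hmem _ hgx)
    rw [hU'] at this
    have := (hshort x hgx).1
    linarith
end

section
/- Assume 0 < G(0) < 1 and let y₀ be a point with −y₀ in the interior of supp(g) satisfying U_{G,α}(y₀) = 0. Then for every y with −y in the interior of supp(g): U_{G,α}(y) < 0 if and only if y > y₀, and U_{G,α}(y) > 0 if and only if y < y₀. In particular, y₀ is the unique zero of U_{G,α} in the interior of its domain. -/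
open Set Filter MeasureTheory


theorem hasDerivAt_integral_Iic {g : ℝ → ℝ} (hc : Continuous g) (hi : Integrable g) (x : ℝ) :
    HasDerivAt (fun y => ∫ t in Iic y, g t) (g x) x := by
  have h : (fun y => ∫ t in Iic y, g t) = fun y => (∫ t in Iic 0, g t) + ∫ t in (0:ℝ)..y, g t := by
    funext y
    rw [← intervalIntegral.integral_Iic_sub_Iic hi.integrableOn hi.integrableOn]
    ring
  rw [h]
  exact ((hc.integral_hasStrictDerivAt 0 x).hasDerivAt).const_add _

section Antiderivative

variable {g G : ℝ → ℝ}

theorem exists_pos_deriv_of_lt (hG : ∀ x, HasDerivAt G (g x) x) {a b : ℝ} (hab : a < b)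
    (h : G a < G b) : ∃ c ∈ Ioo a b, 0 < g c := by
  obtain ⟨c, hc, hgc⟩ := exists_hasDerivAt_eq_slope G g hab
    (fun x _ => (hG x).continuousAt.continuousWithinAt) (fun x _ => hG x)
  exact ⟨c, hc, hgc ▸ div_pos (sub_pos.2 h) (sub_pos.2 hab)⟩

theorem strictMonoOn_Icc_of_hasDerivAt_pos (hG : ∀ x, HasDerivAt G (g x) x) {a b : ℝ}
    (h : ∀ x ∈ Ioo a b, 0 < g x) : StrictMonoOn G (Icc a b) := by
  refine strictMonoOn_of_deriv_pos (convex_Icc a b)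
    (fun x _ => (hG x).continuousAt.continuousWithinAt) fun x hx => ?_
  rw [interior_Icc] at hx
  rw [(hG x).deriv]
  exact h x hx

theorem lt_and_lt_of_deriv_pos (hc : Continuous g) (hG : ∀ x, HasDerivAt G (g x) x)
    (hm : Monotone G) {x : ℝ} (hx : 0 < g x) :
    (∀ a < x, G a < G x) ∧ ∀ b > x, G x < G b := by
  obtain ⟨ε, hε, hball⟩ := Metric.isOpen_iff.1 (isOpen_lt continuous_const hc) x hx
  rw [Real.ball_eq_Ioo] at hball
  have hs := strictMonoOn_Icc_of_hasDerivAt_pos hG fun t ht => hball ht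
  refine ⟨fun a ha => ?_, fun b hb => ?_⟩
  · have h1 : max a (x - ε) < x := max_lt ha (by linarith)
    exact (hm (le_max_left a (x - ε))).trans_lt
      (hs ⟨le_max_right _ _, by linarith⟩ ⟨by linarith, by linarith⟩ h1)
  · have h1 : x < min b (x + ε) := lt_min hb (by linarith)
    exact (hs ⟨by linarith, by linarith⟩ ⟨by linarith, min_le_right _ _⟩ h1).trans_le
      (hm (min_le_left b (x + ε)))

/-- If `(a, b)` and `(a', b')` are shortest intervals around `0` carrying their respective masses,
and the second carries more mass, then its right half carries at least as much mass as the right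
half of the first. -/
theorem right_mass_le_of_shortest (hg_nonneg : ∀ t, 0 ≤ g t)
    (hg_supp : (Function.support g).OrdConnected)
    (hg_incr : StrictMonoOn g (Function.support g ∩ Iic 0)) (hg0 : 0 < g 0)
    (hG : ∀ x, HasDerivAt G (g x) x) (hm : Monotone G)
    {a b a' b' : ℝ} (ha : 0 ≤ a) (hb : 0 ≤ b) (hb' : 0 ≤ b')
    (hlt : G b - G (-a) < G b' - G (-a'))
    (hmin : ∀ c d : ℝ, 0 ≤ c → 0 ≤ d → G d - G (-c) = G b - G (-a) → a + b ≤ c + d)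
    (hmin' : ∀ c d : ℝ, 0 ≤ c → 0 ≤ d → G d - G (-c) = G b' - G (-a') → a' + b' ≤ c + d) :
    G b ≤ G b' := by
  by_contra! hbb
  have hcont : Continuous G := continuous_iff_continuousAt.2 fun x => (hG x).continuousAt
  have haa : -a' < -a := hm.reflect_lt (by linarith)
  -- `-u` cuts the mass `G b - G b'` off the outer end of `[-a', -a]`, `-v` off its inner end
  obtain ⟨u, ⟨hu1, hu2⟩, hu⟩ := intermediate_value_Icc haa.le hcont.continuousOn
    (show G (-a') + (G b - G b') ∈ Icc (G (-a')) (G (-a)) from ⟨by linarith, by linarith⟩)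
  obtain ⟨v, ⟨hv1, hv2⟩, hv⟩ := intermediate_value_Icc haa.le hcont.continuousOn
    (show G (-a) - (G b - G b') ∈ Icc (G (-a')) (G (-a)) from ⟨by linarith, by linarith⟩)
  have h1 := hmin' (-u) b (by linarith) hb (by rw [neg_neg]; linarith)
  have h2 := hmin (-v) b' (by linarith) hb' (by rw [neg_neg]; linarith)
  have hau : -a' < u := hm.reflect_lt (by linarith)
  have hua : u < -a := hm.reflect_lt (by linarith)
  obtain ⟨p, hp, hgp⟩ := exists_pos_deriv_of_lt hG hau (by linarith)
  have hψ : StrictMonoOn (fun s => G s - G (s - (u + a'))) (Icc u (-a)) := by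
    refine strictMonoOn_Icc_of_hasDerivAt_pos (g := fun s => g s - g (s - (u + a')))
      (fun s => (hG s).sub ((hG _).comp_sub_const s _)) fun s hs => ?_
    have hs0 : s ≤ 0 := by linarith [hs.2]
    have hss : s ∈ Function.support g :=
      hg_supp.out (Function.mem_support.2 hgp.ne') (Function.mem_support.2 hg0.ne')
        ⟨(hp.2.trans hs.1).le, hs0⟩
    rw [sub_pos]
    by_cases hz : g (s - (u + a')) = 0
    · rw [hz]
      exact lt_of_le_of_ne (hg_nonneg s) (Ne.symm hss)
    · exact hg_incr ⟨hz, by simp only [mem_Iic]; linarith⟩ ⟨hss, hs0⟩ (by linarith)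
  have h3 := hψ ⟨le_rfl, hua.le⟩ ⟨hua.le, le_rfl⟩ hua
  have h4 : G v ≤ G (-a - (u + a')) := hm (by linarith)
  have h5 : u - (u + a') = -a' := by ring
  simp only [h5] at h3
  linarith

end Antiderivative

/-- Lemma 4(a) of the paper: when `0 < G(0) < 1`, and `y₀` is a zero of `U_{G,α}` with `-y₀`
interior to the support of `g`, then on the domain, `U_{G,α}(y) < 0 ⟺ y > y₀` and
`U_{G,α}(y) > 0 ⟺ y < y₀`; in particular `y₀` is the unique zero of `U_{G,α}` there. -/
theorem stmt9 (α : ℝ) (hα : α ∈ Set.Ioo (0:ℝ) 1)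
    (g G : ℝ → ℝ)
    (hg_cont : Continuous g)
    (hg_nonneg : ∀ t, 0 ≤ g t)
    (hg_supp : (Function.support g).OrdConnected)
    (hg_incr : StrictMonoOn g (Function.support g ∩ Iic 0))
    (hg_decr : StrictAntiOn g (Function.support g ∩ Ici 0))
    (hg_int : Integrable g)
    (hg_one : ∫ t, g t = 1)
    (hG : ∀ y, G y = ∫ t in Iic y, g t)
    (γ₁ γ₂ : ℝ → ℝ)
    (hγ : ∀ Δ : ℝ, 0 < Δ → Δ < 1 →
      0 ≤ γ₁ Δ ∧ 0 ≤ γ₂ Δ ∧ G (γ₂ Δ) - G (-(γ₁ Δ)) = Δ ∧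
        ∀ a b : ℝ, 0 ≤ a → 0 ≤ b → G b - G (-a) = Δ → γ₁ Δ + γ₂ Δ ≤ a + b)
    (U : ℝ → ℝ)
    (hU : ∀ y, U y = -y + γ₁ ((1 - α) * (1 - G (-y))))
    (hG0pos : 0 < G 0) (hG0lt : G 0 < 1)
    (y₀ : ℝ) (hy₀mem : -y₀ ∈ interior (Function.support g)) (hy₀ : U y₀ = 0) :
    (∀ y : ℝ, -y ∈ interior (Function.support g) →
      ((U y < 0 ↔ y₀ < y) ∧ (0 < U y ↔ y < y₀))) ∧
    (∀ y : ℝ, -y ∈ interior (Function.support g) → U y = 0 → y = y₀) := by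
  obtain ⟨hα0, hα1⟩ := hα
  have hG' : G = fun y => ∫ t in Iic y, g t := funext hG
  have hder : ∀ x, HasDerivAt G (g x) x := fun x => by
    rw [hG']
    exact hasDerivAt_integral_Iic hg_cont hg_int x
  have hm : Monotone G := monotone_of_hasDerivAt_nonneg hder hg_nonneg
  have hadd : ∀ x, G x + ∫ t in Ioi x, g t = 1 := fun x => by
    rw [hG, ← hg_one]
    exact intervalIntegral.integral_Iic_add_Ioi hg_int.integrableOn hg_int.integrableOn
  have hG_nonneg : ∀ x, 0 ≤ G x := fun x => by
    rw [hG]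
    exact integral_nonneg hg_nonneg
  have hG_le : ∀ x, G x ≤ 1 := fun x => by
    have h : 0 ≤ ∫ t in Ioi x, g t := integral_nonneg hg_nonneg
    linarith [hadd x]
  have hg0 : 0 < g 0 := by
    obtain ⟨p, hp, hgp⟩ : ∃ p ∈ Iic (0:ℝ), g p ≠ 0 := by
      by_contra! h
      exact hG0pos.ne' ((hG 0).trans (setIntegral_eq_zero_of_forall_eq_zero h))
    obtain ⟨q, hq, hgq⟩ : ∃ q ∈ Ioi (0:ℝ), g q ≠ 0 := by
      by_contra! h
      have := hadd 0
      rw [setIntegral_eq_zero_of_forall_eq_zero h] at this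
      linarith
    exact lt_of_le_of_ne (hg_nonneg 0) (Ne.symm (hg_supp.out hgp hgq ⟨hp, le_of_lt hq⟩))
  have hstrict : ∀ x ∈ interior (Function.support g),
      (∀ a < x, G a < G x) ∧ ∀ b > x, G x < G b := fun x hx =>
    lt_and_lt_of_deriv_pos hg_cont hder hm
      (lt_of_le_of_ne (hg_nonneg x) (Ne.symm (interior_subset hx)))
  have hΔ : ∀ x ∈ interior (Function.support g),
      0 < (1 - α) * (1 - G x) ∧ (1 - α) * (1 - G x) < 1 := fun x hx => by
    have h1 : G x < 1 := ((hstrict x hx).2 (x + 1) (by linarith)).trans_le (hG_le _)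
    have h0 := hG_nonneg x
    exact ⟨mul_pos (by linarith) (by linarith), by nlinarith⟩
  have hmono : ∀ x ∈ interior (Function.support g), ∀ x' ∈ interior (Function.support g), x < x' →
      G x - G (-γ₁ ((1 - α) * (1 - G x))) < G x' - G (-γ₁ ((1 - α) * (1 - G x'))) := by
    intro x hx x' hx' hxx
    have hGx : G x < G x' := (hstrict x hx).2 x' hxx
    obtain ⟨-, hb', he', hmin'⟩ := hγ _ (hΔ x hx).1 (hΔ x hx).2
    obtain ⟨ha, hb, he, hmin⟩ := hγ _ (hΔ x' hx').1 (hΔ x' hx').2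
    have hright := right_mass_le_of_shortest hg_nonneg hg_supp hg_incr hg0 hder hm ha hb hb'
      (by rw [he, he']; nlinarith) (by rw [he]; exact hmin) (by rw [he']; exact hmin')
    nlinarith
  have hzero : G (-y₀) - G (-γ₁ ((1 - α) * (1 - G (-y₀)))) = 0 := by
    have h : -γ₁ ((1 - α) * (1 - G (-y₀))) = -y₀ := by linarith [hU y₀]
    rw [h, sub_self]
  have hneg : ∀ y, -y ∈ interior (Function.support g) → y₀ < y → U y < 0 := fun y hy hlt => by
    have h := hmono _ hy _ hy₀mem (neg_lt_neg hlt)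
    have := hm.reflect_lt (show G (-y) < G (-γ₁ ((1 - α) * (1 - G (-y)))) by linarith)
    linarith [hU y]
  have hpos : ∀ y, -y ∈ interior (Function.support g) → y < y₀ → 0 < U y := fun y hy hlt => by
    have h := hmono _ hy₀mem _ hy (neg_lt_neg hlt)
    have := hm.reflect_lt (show G (-γ₁ ((1 - α) * (1 - G (-y)))) < G (-y) by linarith)
    linarith [hU y]
  refine ⟨fun y hy => ?_, fun y hy hy0 => ?_⟩
  · rcases lt_trichotomy y y₀ with h | rfl | h
    · have := hpos y hy h
      exact ⟨⟨fun _ => by linarith, fun _ => by linarith⟩, fun _ => h, fun _ => this⟩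
    · simp [hy₀]
    · have := hneg y hy h
      exact ⟨⟨fun _ => h, fun _ => this⟩, fun _ => by linarith, fun _ => by linarith⟩
  · rcases lt_trichotomy y y₀ with h | h | h
    · exact absurd hy0 (hpos y hy h).ne'
    · exact h
    · exact absurd hy0 (hneg y hy h).ne
end

section
/- Assume 0 < G(0) < 1 and let y₀ be the unique point with −y₀ in the interior of supp(g) satisfying U_{G,α}(y₀) = 0. Let (Ω, 𝓕, P) be a probability space, S a measurable space, X : Ω → S a random element, a₁, a₂ : S → ℝ measurable with a₂ > 0 everywhere, and τ ≥ 0 a real number, and assume the random variable Z = (τ − a₁(X))/a₂(X) has cumulative distribution function G. Set Δ'(X) = (1−α)·(1 − G(−a₁(X)/a₂(X))) and define l(X) = 0, u(X) = a₁(X) + a₂(X)·G⁻¹(1 − α + α·G(−a₁(X)/a₂(X))) when a₁(X)/a₂(X) ≤ y₀, and l(X) = a₁(X) − a₂(X)·γ₁(Δ'(X)), u(X) = a₁(X) + a₂(X)·γ₂(Δ'(X)) when a₁(X)/a₂(X) > y₀. Then P(l(X) ≤ τ ≤ u(X)) ≥ (1−α)·(1 − G(−y₀)); moreover, if τ = 0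 then P(l(X) ≤ 0 ≤ u(X)) = P(l(X) = 0) = 1 − G(−y₀). -/
open Set Filter MeasureTheory

open Topology

theorem exists_shift_of_deriv_lt {F f : ℝ → ℝ} (hF : ∀ x, HasDerivAt F (f x) x)
    (hmono : Monotone F) {x y η : ℝ} (h : f x < f y) (hη : 0 < η) :
    ∃ ε δ, 0 < ε ∧ ε < η ∧ 0 ≤ δ ∧ δ < ε ∧ F (x + ε) - F x = F (y + δ) - F y := by
  have hd : HasDerivAt (fun t ↦ F (y + t) - F (x + t)) (f y - f x) 0 := by
    have h1 : HasDerivAt (fun t ↦ F (y + t)) (f y) 0 := by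
      apply HasDerivAt.comp_const_add
      simpa using hF y
    have h2 : HasDerivAt (fun t ↦ F (x + t)) (f x) 0 := by
      apply HasDerivAt.comp_const_add
      simpa using hF x
    exact h1.sub h2
  have hev := (hasDerivAt_iff_tendsto_slope_zero.1 hd).eventually (lt_mem_nhds (sub_pos.2 h))
  have hev' : ∀ᶠ t in 𝓝[>] (0 : ℝ), 0 < t⁻¹ • (F (y + (0 + t)) - F (x + (0 + t))
      - (F (y + 0) - F (x + 0))) :=
    hev.filter_mono (nhdsWithin_mono _ fun t (ht : 0 < t) ↦ ht.ne')
  obtain ⟨ε, hε, hε0, hεη⟩ := (hev'.and (Ioo_mem_nhdsGT hη)).exists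
  have hlt : 0 < F (y + ε) - F (x + ε) - (F y - F x) := by
    simpa [hε0] using hε
  have hcont : ContinuousOn (fun t ↦ F (y + t) - F y) (Icc 0 ε) := by
    have : Continuous F := continuous_iff_continuousAt.2 fun x ↦ (hF x).continuousAt
    fun_prop
  have hx : F x ≤ F (x + ε) := hmono (by linarith)
  obtain ⟨δ, ⟨hδ0, hδε⟩, hδ⟩ := intermediate_value_Icc hε0.le hcont
    (show F (x + ε) - F x ∈ Icc _ _ from ⟨by simpa using hx, by linarith⟩)
  refine ⟨ε, δ, hε0, hεη, hδ0, lt_of_le_of_ne hδε ?_, hδ.symm⟩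
  rintro rfl
  simp only at hδ
  linarith

/-- The endpoints of a shortest interval of given mass around the mode have equal density. -/
theorem density_eq_of_length_minimal {G g : ℝ → ℝ} (hG : ∀ x, HasDerivAt G (g x) x)
    (hmono : Monotone G) (hmax : ∀ x, x ≠ 0 → g x < g 0) {a b : ℝ} (ha : 0 ≤ a) (hb : 0 ≤ b)
    (hmin : ∀ a' b', 0 ≤ a' → 0 ≤ b' → G b' - G (-a') = G b - G (-a) → a + b ≤ a' + b') :
    g (-a) = g b := by
  have hle : ∀ x, g x ≤ g 0 := fun x ↦ by
    rcases eq_or_ne x 0 with rfl | hx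
    exacts [le_rfl, (hmax x hx).le]
  apply le_antisymm
  · by_contra! hlt
    have hb0 : 0 < b := hb.lt_of_ne' (by rintro rfl; exact (hle _).not_gt hlt)
    have hderiv : ∀ x, HasDerivAt (fun t ↦ -G (-t)) (g (-x)) x := fun x ↦ by
      have : HasDerivAt (fun t ↦ -G (-t)) (-(g (-x) * -1)) x :=
        ((hG (-x)).comp x (hasDerivAt_neg x)).neg
      rwa [mul_neg_one, neg_neg] at this
    obtain ⟨ε, δ, h1, h2, h3, h4, h5⟩ := exists_shift_of_deriv_lt hderiv
      (fun x y hxy ↦ neg_le_neg (hmono (neg_le_neg hxy))) (x := -b) (y := a)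
      (by simpa using hlt) hb0
    have h6 : -(-b + ε) = b - ε := by ring
    rw [h6, neg_neg] at h5
    have := hmin (a + δ) (b - ε) (by linarith) (by linarith) (by linarith)
    linarith
  · by_contra! hlt
    have ha0 : 0 < a := ha.lt_of_ne' (by rintro rfl; exact (hle b).not_gt (by simpa using hlt))
    obtain ⟨ε, δ, h1, h2, h3, h4, h5⟩ := exists_shift_of_deriv_lt hG hmono hlt ha0
    have h6 : -(a - ε) = -a + ε := by ring
    have := hmin (a - ε) (b + δ) (by linarith) (by linarith) (by rw [h6]; linarith)
    linarith

/-- Intervals around the mode with equal density at their endpoints are nested by mass. -/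
theorem endpoints_le_of_mass_le {G g : ℝ → ℝ}
    (hGlt : ∀ x y c, x < y → c ∈ Icc x y → 0 < g c → G x < G y)
    (hup : ∀ x y, x < y → y ≤ 0 → 0 < g x → g x < g y)
    (hdn : ∀ x y, 0 ≤ x → x < y → 0 < g y → g y < g x)
    {a b a' b' : ℝ} (ha' : 0 ≤ a') (hb' : 0 ≤ b')
    (ha : 0 ≤ a) (hb : 0 ≤ b) (hpos : 0 < g b)
    (heq : g (-a) = g b) (heq' : g (-a') = g b') (hmass : G b - G (-a) ≤ G b' - G (-a')) :
    a ≤ a' ∧ b ≤ b' := by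
  have key : ¬ (a' < a ∧ b' < b) := fun ⟨h1, h2⟩ ↦ by
    have h3 := hGlt b' b b h2 ⟨h2.le, le_rfl⟩ hpos
    have h4 := hGlt (-a) (-a') (-a) (by linarith) ⟨le_rfl, by linarith⟩ (heq ▸ hpos)
    linarith
  refine ⟨not_lt.1 fun h ↦ key ⟨h, not_le.1 fun hb2 ↦ ?_⟩,
    not_lt.1 fun h ↦ key ⟨not_le.1 fun ha2 ↦ ?_, h⟩⟩
  · have h1 := hup (-a) (-a') (by linarith) (by linarith) (heq ▸ hpos)
    rcases hb2.eq_or_lt with rfl | hlt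
    · linarith
    · have := hdn b b' hb hlt (by linarith)
      linarith
  · have h1 := hdn b' b hb' h hpos
    rcases ha2.eq_or_lt with rfl | hlt
    · linarith
    · have := hup (-a') (-a) (by linarith) (by linarith) (by linarith)
      linarith

section DistributionFunction

variable {Ω : Type*} [MeasurableSpace Ω] {P : Measure Ω} [IsProbabilityMeasure P]
  {Z : Ω → ℝ} {G : ℝ → ℝ}

theorem measureReal_Ioc_of_cdf (hZm : Measurable Z)
    (hZ : ∀ y, P.real {ω | Z ω ≤ y} = G y) {x y : ℝ} (hxy : x ≤ y) :
    P.real {ω | x < Z ω ∧ Z ω ≤ y} = G y - G x := by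
  have hsub : {ω | Z ω ≤ x} ⊆ {ω | Z ω ≤ y} := fun ω (h : Z ω ≤ x) ↦ h.trans hxy
  rw [← hZ y, ← hZ x, ← measureReal_sdiff hsub (measurableSet_le hZm measurable_const)]
  congr 1
  ext ω
  simp [and_comm]

theorem measureReal_Ici_of_cdf (hZm : Measurable Z)
    (hZ : ∀ y, P.real {ω | Z ω ≤ y} = G y) (hG : Continuous G) (c : ℝ) :
    P.real {ω | c ≤ Z ω} = 1 - G c := by
  have hlt : P.real {ω | Z ω < c} = G c := by
    apply le_antisymm
    · rw [← hZ c]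
      exact measureReal_mono fun ω (h : Z ω < c) ↦ h.le
    · refine le_of_tendsto (hG.tendsto c |>.mono_left (nhdsWithin_le_nhds (s := Iio c))) ?_
      filter_upwards [self_mem_nhdsWithin] with x (hx : x < c)
      rw [← hZ x]
      exact measureReal_mono fun ω (h : Z ω ≤ x) ↦ h.trans_lt hx
  rw [← hlt, ← probReal_compl_eq_one_sub (measurableSet_lt hZm measurable_const)]
  congr 1
  ext ω
  simp

theorem measureReal_cdf_eq_one (hZm : Measurable Z)
    (hZ : ∀ y, P.real {ω | Z ω ≤ y} = G y) (hsurj : ∀ p, 0 < p → p < 1 → ∃ x, G x = p) :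
    P.real {ω | G (Z ω) = 1} = 0 := by
  refine le_antisymm (le_of_forall_pos_le_add fun ε hε ↦ ?_) measureReal_nonneg
  obtain ⟨x, hx⟩ := hsurj (1 - min ε 2⁻¹) (by linarith [min_le_right ε 2⁻¹])
    (by linarith [lt_min hε (by norm_num : (0 : ℝ) < 2⁻¹)])
  have hmono : Monotone G := fun x y hxy ↦ by
    rw [← hZ x, ← hZ y]
    exact measureReal_mono fun ω (h : Z ω ≤ x) ↦ h.trans hxy
  calc P.real {ω | G (Z ω) = 1} ≤ P.real {ω | Z ω ≤ x}ᶜ := by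
        refine measureReal_mono fun ω (h : G (Z ω) = 1) (h' : Z ω ≤ x) ↦ ?_
        have := hmono h'
        linarith [lt_min hε (by norm_num : (0 : ℝ) < 2⁻¹)]
    _ = 1 - G x := by rw [probReal_compl_eq_one_sub (measurableSet_le hZm measurable_const), hZ]
    _ ≤ 0 + ε := by linarith [min_le_left ε 2⁻¹]

end DistributionFunction

/-- Theorem 2(c) of the paper: for the class `𝒞₁` (i.e. `0 < G(0) < 1`), the HPD interval
`[l(X), u(X)]` of Lemma 5 has coverage greater than `(1-α)(1-G(-y₀))` for any `τ ≥ 0`, and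
its coverage of the boundary value `τ = 0` equals `P(l(X) = 0) = 1 - G(-y₀)`. -/
theorem stmt14 {Ω S : Type*} [MeasurableSpace Ω] [MeasurableSpace S]
    (P : Measure Ω) [IsProbabilityMeasure P]
    (α : ℝ) (hα : α ∈ Set.Ioo (0:ℝ) 1)
    (g G Ginv : ℝ → ℝ)
    (hg_cont : Continuous g)
    (hg_nonneg : ∀ t, 0 ≤ g t)
    (hg_supp : (Function.support g).OrdConnected)
    (hg_incr : StrictMonoOn g (Function.support g ∩ Iic 0))
    (hg_decr : StrictAntiOn g (Function.support g ∩ Ici 0))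
    (hg_int : Integrable g)
    (hg_one : ∫ t, g t = 1)
    (hG : ∀ y, G y = ∫ t in Iic y, g t)
    (hGinv : ∀ p : ℝ, 0 < p → p < 1 →
      Ginv p ∈ interior (Function.support g) ∧ G (Ginv p) = p)
    (γ₁ γ₂ : ℝ → ℝ)
    (hγ : ∀ Δ : ℝ, 0 < Δ → Δ < 1 →
      0 ≤ γ₁ Δ ∧ 0 ≤ γ₂ Δ ∧ G (γ₂ Δ) - G (-(γ₁ Δ)) = Δ ∧
        ∀ a b : ℝ, 0 ≤ a → 0 ≤ b → G b - G (-a) = Δ → γ₁ Δ + γ₂ Δ ≤ a + b)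
    (U : ℝ → ℝ)
    (hU : ∀ y, U y = -y + γ₁ ((1 - α) * (1 - G (-y))))
    (hG0pos : 0 < G 0) (hG0lt : G 0 < 1)
    (y₀ : ℝ) (hy₀mem : -y₀ ∈ interior (Function.support g)) (hy₀ : U y₀ = 0)
    (X : Ω → S) (hX : Measurable X)
    (a₁ a₂ : S → ℝ) (ha₁ : Measurable a₁) (ha₂ : Measurable a₂)
    (ha₂pos : ∀ s, 0 < a₂ s)
    (τ : ℝ) (hτ : 0 ≤ τ)
    (hZ : ∀ y : ℝ, (P {ω | (τ - a₁ (X ω)) / a₂ (X ω) ≤ y}).toReal = G y)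
    (l u : S → ℝ)
    (hl : ∀ s, l s = if a₁ s / a₂ s ≤ y₀ then 0
      else a₁ s - a₂ s * γ₁ ((1 - α) * (1 - G (-(a₁ s / a₂ s)))))
    (hu : ∀ s, u s = if a₁ s / a₂ s ≤ y₀
      then a₁ s + a₂ s * Ginv (1 - α + α * G (-(a₁ s / a₂ s)))
      else a₁ s + a₂ s * γ₂ ((1 - α) * (1 - G (-(a₁ s / a₂ s))))) :
    (1 - α) * (1 - G (-y₀)) ≤ (P {ω | l (X ω) ≤ τ ∧ τ ≤ u (X ω)}).toReal ∧
    (τ = 0 →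
      (P {ω | l (X ω) ≤ 0 ∧ (0:ℝ) ≤ u (X ω)}).toReal = (P {ω | l (X ω) = 0}).toReal ∧
      (P {ω | l (X ω) = 0}).toReal = 1 - G (-y₀)) := by
  obtain ⟨hα0, hα1⟩ := hα
  set Z : Ω → ℝ := fun ω ↦ (τ - a₁ (X ω)) / a₂ (X ω) with hZdef
  have hZm : Measurable Z :=
    (measurable_const.sub (ha₁.comp hX)).div (ha₂.comp hX)
  have hZ' : ∀ y, P.real {ω | Z ω ≤ y} = G y := hZ
  have hG_nonneg : ∀ y, 0 ≤ G y := fun y ↦ hZ' y ▸ measureReal_nonneg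
  have hG_le : ∀ y, G y ≤ 1 := fun y ↦ hZ' y ▸ measureReal_le_one
  have hG_sub : ∀ x y, G y - G x = ∫ t in x..y, g t := fun x y ↦ by
    rw [hG, hG, intervalIntegral.integral_Iic_sub_Iic hg_int.integrableOn hg_int.integrableOn]
  have hderiv : ∀ x, HasDerivAt G (g x) x := fun x ↦ by
    have h1 : G = fun y ↦ G 0 + ∫ t in (0 : ℝ)..y, g t := by
      funext y
      rw [← hG_sub]
      ring
    rw [h1]
    exact (hg_cont.integral_hasStrictDerivAt 0 x).hasDerivAt.const_add _
  have hGcont : Continuous G := continuous_iff_continuousAt.2 fun x ↦ (hderiv x).continuousAt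
  have hGmono : Monotone G := fun x y hxy ↦ by
    rw [← sub_nonneg, hG_sub]
    exact intervalIntegral.integral_nonneg hxy fun t _ ↦ hg_nonneg t
  have hGlt : ∀ x y c, x < y → c ∈ Icc x y → 0 < g c → G x < G y := fun x y c hxy hc hgc ↦ by
    rw [← sub_pos, hG_sub]
    exact intervalIntegral.integral_pos hxy hg_cont.continuousOn (fun t _ ↦ hg_nonneg t)
      ⟨c, hc, hgc⟩
  have hpos_of_mem : ∀ x, x ∈ Function.support g → 0 < g x := fun x hx ↦
    (hg_nonneg x).lt_of_ne' hx
  have hg0 : 0 < g 0 := by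
    obtain ⟨h1, h2⟩ := hGinv (G 0) hG0pos hG0lt
    have h3 := hpos_of_mem _ (interior_subset h1)
    rcases lt_trichotomy (Ginv (G 0)) 0 with h | h | h
    · exact absurd (hGlt _ _ _ h ⟨le_rfl, h.le⟩ h3) h2.not_lt
    · rwa [h] at h3
    · exact absurd (hGlt _ _ _ h ⟨h.le, le_rfl⟩ h3) h2.not_gt
  have hmem0 : (0 : ℝ) ∈ Function.support g := hg0.ne'
  have hup : ∀ x y, x < y → y ≤ 0 → 0 < g x → g x < g y := fun x y hxy hy hx ↦
    hg_incr ⟨hx.ne', hxy.le.trans hy⟩ ⟨hg_supp.out hx.ne' hmem0 ⟨hxy.le, hy⟩, hy⟩ hxy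
  have hdn : ∀ x y, 0 ≤ x → x < y → 0 < g y → g y < g x := fun x y hx hxy hy ↦
    hg_decr ⟨hg_supp.out hmem0 hy.ne' ⟨hx, hxy.le⟩, hx⟩ ⟨hy.ne', hx.trans hxy.le⟩ hxy
  have hmax : ∀ x, x ≠ 0 → g x < g 0 := fun x hx ↦ by
    rcases (hg_nonneg x).eq_or_lt with h | h
    · rwa [← h]
    rcases hx.lt_or_gt with hx | hx
    exacts [hup x 0 hx le_rfl h, hdn 0 x le_rfl hx h]
  have hγeq : ∀ Δ, 0 < Δ → Δ < 1 → g (-γ₁ Δ) = g (γ₂ Δ) := fun Δ h0 h1 ↦ by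
    obtain ⟨ha, hb, hm, hmin⟩ := hγ Δ h0 h1
    refine density_eq_of_length_minimal hderiv hGmono hmax ha hb fun a' b' ha' hb' h ↦ ?_
    exact hmin a' b' ha' hb' (h.trans hm)
  have hγpos : ∀ Δ, 0 < Δ → Δ < 1 → 0 < g (γ₂ Δ) := fun Δ h0 h1 ↦ by
    refine (hg_nonneg _).lt_of_ne fun h ↦ ?_
    obtain ⟨ha, hb, hm, -⟩ := hγ Δ h0 h1
    have hz : g (-γ₁ Δ) = 0 := (hγeq Δ h0 h1).trans h.symm
    have hone : G (γ₂ Δ) < 1 := by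
      by_contra! hge
      have hone : G (γ₂ Δ) = 1 := le_antisymm (hG_le _) hge
      obtain ⟨h2, h3⟩ := hGinv (G (-γ₁ Δ) / 2) (by linarith) (by linarith)
      have hlt : Ginv (G (-γ₁ Δ) / 2) < -γ₁ Δ := by
        by_contra! hle
        have := hGmono hle
        linarith
      exact hg_supp.out (interior_subset h2) hmem0 ⟨hlt.le, by linarith⟩ hz
    obtain ⟨h2, h3⟩ := hGinv ((1 + G (γ₂ Δ)) / 2)
      (by linarith [hG_nonneg (γ₂ Δ)]) (by linarith)
    have hlt : γ₂ Δ < Ginv ((1 + G (γ₂ Δ)) / 2) := by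
      by_contra! hle
      have := hGmono hle
      linarith
    exact hg_supp.out hmem0 (interior_subset h2) ⟨hb, hlt.le⟩ h.symm
  have hΔ : ∀ y, 0 ≤ y → 0 < (1 - α) * (1 - G (-y)) ∧ (1 - α) * (1 - G (-y)) < 1 :=
    fun y hy ↦ by
      have h1 : G (-y) ≤ G 0 := hGmono (by linarith)
      have h2 := hG_nonneg (-y)
      exact ⟨mul_pos (by linarith) (by linarith), by nlinarith⟩
  have hy₀pos : 0 < g (-y₀) := hpos_of_mem _ (interior_subset hy₀mem)
  have hγy₀ : γ₁ ((1 - α) * (1 - G (-y₀))) = y₀ := by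
    have := hU y₀
    linarith
  have hGy₀ : G (-y₀) < 1 := by
    refine (hG_le _).lt_of_ne fun h ↦ hy₀pos.ne' ?_
    exact IsLocalMax.hasDerivAt_eq_zero (Eventually.of_forall fun x ↦ h ▸ hG_le x) (hderiv _)
  have hΔ₀ : 0 < (1 - α) * (1 - G (-y₀)) ∧ (1 - α) * (1 - G (-y₀)) < 1 := by
    have h2 := hG_nonneg (-y₀)
    exact ⟨mul_pos (by linarith) (by linarith), by nlinarith⟩
  obtain ⟨hy₀nn, hb₀, hm₀, -⟩ := hγ _ hΔ₀.1 hΔ₀.2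
  have heq₀ := hγeq _ hΔ₀.1 hΔ₀.2
  have hpos₀ := hγpos _ hΔ₀.1 hΔ₀.2
  rw [hγy₀] at hy₀nn hm₀ heq₀
  set b₀ := γ₂ ((1 - α) * (1 - G (-y₀)))
  have hnest : ∀ y, y₀ < y → y₀ ≤ γ₁ ((1 - α) * (1 - G (-y))) ∧
      b₀ ≤ γ₂ ((1 - α) * (1 - G (-y))) := fun y hy ↦ by
    obtain ⟨h0, h1⟩ := hΔ y (by linarith)
    obtain ⟨ha, hb, hm, -⟩ := hγ _ h0 h1
    refine endpoints_le_of_mass_le hGlt hup hdn ha hb hy₀nn hb₀ hpos₀ heq₀ (hγeq _ h0 h1) ?_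
    rw [hm, hm₀]
    have : G (-y) ≤ G (-y₀) := hGmono (by linarith)
    exact mul_le_mul_of_nonneg_left (by linarith) (by linarith)
  have hUneg : ∀ y, y₀ < y → γ₁ ((1 - α) * (1 - G (-y))) < y := fun y hy ↦ by
    by_contra! hle
    obtain ⟨h0, h1⟩ := hΔ y (by linarith)
    obtain ⟨ha, hb, hm, -⟩ := hγ _ h0 h1
    have heq := hγeq _ h0 h1
    have hpos := hγpos _ h0 h1
    have hb₀le := (hnest y hy).2
    set a := γ₁ ((1 - α) * (1 - G (-y)))
    set b := γ₂ ((1 - α) * (1 - G (-y)))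
    have hgy : 0 < g (-y) := hpos_of_mem _ <| hg_supp.out (x := -a)
      (by rw [Function.mem_support, heq]; exact hpos.ne') hmem0 ⟨by linarith, by linarith⟩
    have h2 : G (-y) < G (-y₀) := hGlt _ _ (-y) (by linarith) ⟨le_rfl, by linarith⟩ hgy
    have h3 : G (-a) ≤ G (-y) := hGmono (by linarith)
    have h4 : G b₀ ≤ G b := hGmono hb₀le
    nlinarith
  constructor
  · calc (1 - α) * (1 - G (-y₀)) = G b₀ - G (-y₀) := hm₀.symm
      _ = P.real {ω | -y₀ < Z ω ∧ Z ω ≤ b₀} :=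
        (measureReal_Ioc_of_cdf hZm hZ' (by linarith)).symm
      _ ≤ P.real {ω | l (X ω) ≤ τ ∧ τ ≤ u (X ω)} := by
        refine measureReal_mono fun ω hω ↦ ?_
        obtain ⟨h1, h2⟩ := hω
        simp only [mem_ofPred_eq, hl, hu]
        have hap := ha₂pos (X ω)
        have hτeq : τ = a₁ (X ω) + a₂ (X ω) * Z ω := by
          simp only [hZdef]
          field_simp
          ring
        split_ifs with hc
        · refine ⟨hτ, ?_⟩
          have h3 : -(a₁ (X ω) / a₂ (X ω)) ≤ Z ω := by
            rw [← neg_div]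
            exact div_le_div_of_nonneg_right (by linarith) hap.le
          have h4 : G (-y₀) ≤ G (-(a₁ (X ω) / a₂ (X ω))) := hGmono (by linarith)
          have hG1 : G (-(a₁ (X ω) / a₂ (X ω))) ≤ G b₀ := hGmono (by linarith)
          have hG2 : G b₀ < 1 := by nlinarith
          have hGn := hG_nonneg (-(a₁ (X ω) / a₂ (X ω)))
          obtain ⟨h5, h6⟩ := hGinv (1 - α + α * G (-(a₁ (X ω) / a₂ (X ω))))
            (by nlinarith) (by nlinarith)
          have h7 : b₀ ≤ Ginv (1 - α + α * G (-(a₁ (X ω) / a₂ (X ω)))) := by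
            by_contra! hlt
            have := hGlt _ _ b₀ hlt ⟨hlt.le, le_rfl⟩ hpos₀
            nlinarith
          have := mul_le_mul_of_nonneg_left (h2.trans h7) hap.le
          linarith
        · obtain ⟨h3, h4⟩ := hnest _ (not_le.1 hc)
          have h5 := mul_le_mul_of_nonneg_left (h2.trans h4) hap.le
          have h6 := mul_le_mul_of_nonneg_left (h1.le.trans' (neg_le_neg h3)) hap.le
          constructor <;> linarith
  · rintro rfl
    have hZeq : ∀ ω, Z ω = -(a₁ (X ω) / a₂ (X ω)) := fun ω ↦ by
      simp only [hZdef]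
      ring
    have hlpos : ∀ s, y₀ < a₁ s / a₂ s → 0 < l s := fun s hs ↦ by
      rw [hl, if_neg hs.not_ge, sub_pos]
      have := mul_lt_mul_of_pos_left (hUneg _ hs) (ha₂pos s)
      rwa [mul_div_cancel₀ _ (ha₂pos s).ne'] at this
    have hl0 : {ω | l (X ω) = 0} = {ω | -y₀ ≤ Z ω} := by
      ext ω
      simp only [mem_ofPred_eq, hZeq, neg_le_neg_iff]
      refine ⟨fun h ↦ not_lt.1 fun hlt ↦ (hlpos _ hlt).ne' h, fun h ↦ by rw [hl, if_pos h]⟩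
    refine ⟨?_, ?_⟩
    · change P.real _ = P.real _
      rw [hl0]
      apply le_antisymm
      · refine measureReal_mono fun ω hω ↦ ?_
        rw [← hl0]
        by_contra hne
        rw [hl0, mem_ofPred_eq, hZeq, neg_le_neg_iff, not_le] at hne
        exact (hlpos _ hne).not_ge hω.1
      · calc P.real {ω | -y₀ ≤ Z ω}
            ≤ P.real ({ω | l (X ω) ≤ 0 ∧ 0 ≤ u (X ω)} ∪ {ω | G (Z ω) = 1}) := by
              refine measureReal_mono fun ω hω ↦ ?_
              by_cases hone : G (Z ω) = 1
              · exact Or.inr hone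
              left
              have hc : a₁ (X ω) / a₂ (X ω) ≤ y₀ := by
                rw [mem_ofPred_eq, hZeq] at hω
                linarith
              have hap := ha₂pos (X ω)
              simp only [mem_ofPred_eq, hl, hu, if_pos hc, le_refl, true_and]
              rw [← hZeq]
              have hlt : G (Z ω) < 1 := (hG_le _).lt_of_ne hone
              have hn := hG_nonneg (Z ω)
              obtain ⟨-, h6⟩ := hGinv (1 - α + α * G (Z ω)) (by nlinarith) (by nlinarith)
              have h7 : Z ω ≤ Ginv (1 - α + α * G (Z ω)) := by
                by_contra! h
                have := hGmono h.le
                nlinarith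
              have h8 := mul_le_mul_of_nonneg_left h7 hap.le
              have h9 : a₂ (X ω) * Z ω = -a₁ (X ω) := by
                rw [hZeq]
                field_simp
              linarith
          _ ≤ _ := measureReal_union_le _ _
          _ = _ := by
            rw [measureReal_cdf_eq_one hZm hZ' fun p h0 h1 ↦ ⟨_, (hGinv p h0 h1).2⟩, add_zero]
    · change P.real _ = _
      rw [hl0]
      exact measureReal_Ici_of_cdf hZm hZ' hGcont _
end

section
/- Assume 0 < G(0) < 1, let y₀ be the unique point with −y₀ in the interior of supp(g) satisfying U_{G,α}(y₀) = 0, and assume the skewness condition G(−γ₁(1 − z)) ≤ z/2 for every z ∈ (0,1]. Then 1 − G(−y₀) ≥ 1/(1+α). -/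
open Set Filter MeasureTheory

/-- Key step in Corollary 2 of the paper: under the right-skewness condition
`G(-γ₁(1-z)) ≤ z/2` for all `z ∈ (0,1]`, and `0 < G(0) < 1`, the zero `y₀` of `U_{G,α}`
satisfies `1 - G(-y₀) ≥ 1/(1+α)`. -/
theorem stmt15 (α : ℝ) (hα : α ∈ Set.Ioo (0:ℝ) 1)
    (g G : ℝ → ℝ)
    (hg_cont : Continuous g)
    (hg_nonneg : ∀ t, 0 ≤ g t)
    (hg_supp : (Function.support g).OrdConnected)
    (hg_incr : StrictMonoOn g (Function.support g ∩ Iic 0))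
    (hg_decr : StrictAntiOn g (Function.support g ∩ Ici 0))
    (hg_int : Integrable g)
    (hg_one : ∫ t, g t = 1)
    (hG : ∀ y, G y = ∫ t in Iic y, g t)
    (γ₁ γ₂ : ℝ → ℝ)
    (hγ : ∀ Δ : ℝ, 0 < Δ → Δ < 1 →
      0 ≤ γ₁ Δ ∧ 0 ≤ γ₂ Δ ∧ G (γ₂ Δ) - G (-(γ₁ Δ)) = Δ ∧
        ∀ a b : ℝ, 0 ≤ a → 0 ≤ b → G b - G (-a) = Δ → γ₁ Δ + γ₂ Δ ≤ a + b)
    (hγ₁0 : γ₁ 0 = 0) (hγ₂0 : γ₂ 0 = 0)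
    (U : ℝ → ℝ)
    (hU : ∀ y, U y = -y + γ₁ ((1 - α) * (1 - G (-y))))
    (hG0pos : 0 < G 0) (hG0lt : G 0 < 1)
    (y₀ : ℝ) (hy₀mem : -y₀ ∈ interior (Function.support g)) (hy₀ : U y₀ = 0)
    (hskew : ∀ z : ℝ, 0 < z → z ≤ 1 → G (-(γ₁ (1 - z))) ≤ z / 2) :
    1 / (1 + α) ≤ 1 - G (-y₀) := by
  have h_nonneg : 0 ≤ G (-y₀) := by
    rw [hG]
    exact integral_nonneg hg_nonneg
  have h_le_one : G (-y₀) ≤ 1 := by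
    rw [hG, ← hg_one]
    exact setIntegral_le_integral hg_int (Eventually.of_forall hg_nonneg)
  obtain ⟨hα0, hα1⟩ := hα
  have h_zero : γ₁ ((1 - α) * (1 - G (-y₀))) = y₀ := by
    linarith [hU y₀]
  have h_skew := hskew (1 - (1 - α) * (1 - G (-y₀))) (by nlinarith) (by nlinarith)
  rw [sub_sub_cancel, h_zero] at h_skew
  rw [div_le_iff₀ (by linarith)]
  linarith
end
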